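/- arXiv:2011.14367 — 2 statements merged into one kernel-verified Lean document; each statement's English description precedes it below -/
import Mathlib

section
/- The set of subfields F of the algebraic closure of ℚ that are Hilbertian is a dense G_δ subset (in particular a comeager subset) of the space 𝓔 of all subfields of the algebraic closure of ℚ. -/
open FirstOrder Topology

noncomputable section

/-- `Q̄`, the algebraic closure of `ℚ`. -/
abbrev Qbar : Type := AlgebraicClosure ℚ

/-- `Prop` with the discrete two-point topology. -/
def propDiscrete : TopologicalSpace Prop := ⊥

/-- The product topology on the powerset `2^Q̄`, identified with `Set Q̄ = Q̄ → Prop`,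
where each factor `Prop` carries the discrete two-point topology. -/
def powersetTopology : TopologicalSpace (Set Qbar) :=
  @Pi.topologicalSpace Qbar (fun _ => Prop) (fun _ => propDiscrete)

/-- The space `𝓔` of all subfields of `Q̄`, with the subspace topology induced from `2^Q̄`
via the identification of a subfield with its underlying set of elements. -/
instance subfieldTopology : TopologicalSpace (Subfield Qbar) :=
  powersetTopology.induced (fun F => (F : Set Qbar))

/-- A subfield `F` of `Q̄` is Hilbertian if for all `n ≥ 1`, all absolutely irreducible
`f₁, …, fₙ ∈ F[X,Y]` (viewed as polynomials in `Y` over `F[X]`) that are monic of degree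
at least `2` in `Y`, and all nonzero `g ∈ F[X]`, there is `x ∈ F` with `g(x) ≠ 0` such that
each one-variable polynomial `fᵢ(x,Y)` has no root in `F`. -/
def IsHilbertian (F : Subfield Qbar) : Prop :=
  ∀ (n : ℕ), 0 < n → ∀ (f : Fin n → Polynomial (Polynomial F)) (g : Polynomial F),
    (∀ i, Irreducible ((f i).map (Polynomial.mapRingHom F.subtype))) →
    (∀ i, (f i).Monic) →
    (∀ i, 2 ≤ (f i).natDegree) →
    g ≠ 0 →
    ∃ x : F, Polynomial.eval x g ≠ 0 ∧
      ∀ i, ∀ y : F, Polynomial.eval y ((f i).map (Polynomial.evalRingHom x)) ≠ 0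

open Polynomial in
theorem exists_norm_root_le_mul_pow (h : ℂ[X][X]) (hm : h.Monic) (e : ℕ)
    (he : ∀ k, (h.coeff k).natDegree ≤ e) :
    ∃ C : ℝ, 0 ≤ C ∧ ∀ t y : ℂ, 1 ≤ ‖t‖ → (h.map (evalRingHom t)).eval y = 0 →
      ‖y‖ ≤ C * ‖t‖ ^ e := by
  set S : ℕ → ℝ := fun k => ∑ m ∈ Finset.range (e + 1), ‖(h.coeff k).coeff m‖ with hS
  have hS0 : ∀ k, 0 ≤ S k := fun k => Finset.sum_nonneg fun _ _ => norm_nonneg _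
  set T : ℝ := ∑ k ∈ Finset.range h.natDegree, S k with hT
  have hT0 : 0 ≤ T := Finset.sum_nonneg fun k _ => hS0 k
  refine ⟨T + 1, by positivity, fun t y ht hy => ?_⟩
  have hpm : (h.map (evalRingHom t)).Monic := hm.map _
  have hc : ∀ k, ‖(h.coeff k).eval t‖ ≤ S k * ‖t‖ ^ e := by
    intro k
    rw [eval_eq_sum_range' (Nat.lt_succ_of_le (he k)), hS, Finset.sum_mul]
    refine (norm_sum_le _ _).trans (Finset.sum_le_sum fun m hmr => ?_)
    rw [norm_mul, norm_pow]
    have : m ≤ e := Nat.le_of_lt_succ (Finset.mem_range.1 hmr)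
    gcongr
  have hb := (IsRoot.norm_lt_cauchyBound hpm.ne_zero hy).le
  have hb' : ‖y‖ ≤ ((h.map (evalRingHom t)).cauchyBound : ℝ) := by exact_mod_cast hb
  refine hb'.trans ?_
  rw [cauchyBound, hpm.leadingCoeff, hm.natDegree_map]
  have h1 : (1 : ℝ) ≤ ‖t‖ ^ e := one_le_pow₀ ht
  have h2 : Finset.sup (Finset.range h.natDegree)
      (fun k => ‖(h.map (evalRingHom t)).coeff k‖₊) ≤ Real.toNNReal (T * ‖t‖ ^ e) := by
    refine Finset.sup_le fun k hk => ?_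
    refine NNReal.le_toNNReal_of_coe_le ?_
    simp only [coe_nnnorm, coeff_map, coe_evalRingHom]
    refine (hc k).trans ?_
    gcongr
    exact Finset.single_le_sum (f := S) (fun k _ => hS0 k) hk
  have h3 := NNReal.coe_le_coe.2 h2
  rw [Real.coe_toNNReal _ (by positivity)] at h3
  simp only [nnnorm_one, div_one, NNReal.coe_add, NNReal.coe_one]
  nlinarith

open Polynomial in
theorem isIntegral_of_monic_of_coeff {A : Type*} [CommRing A] (p : A[X]) (hp : p.Monic)
    (hc : ∀ k, IsIntegral ℤ (p.coeff k)) {y : A} (hy : p.eval y = 0) : IsIntegral ℤ y := by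
  obtain ⟨P, hP, -, hPm⟩ := lifts_and_natDegree_eq_and_monic
    (f := algebraMap (integralClosure ℤ A) A) (p := p)
    ((lifts_iff_coeff_lifts _).2 fun k => ⟨⟨_, hc k⟩, rfl⟩) hp
  refine isIntegral_trans (A := integralClosure ℤ A) y ⟨P, hPm, ?_⟩
  rw [← hP, eval_map] at hy
  exact hy

open Polynomial in
theorem exists_isIntegral_mul_root {K : Type*} [Field K] [NumberField K] (f : K[X][X])
    (hf : f.Monic) : ∃ N : ℤ, N ≠ 0 ∧ ∀ (φ : K →+* ℂ) (t y : ℂ), IsIntegral ℤ t →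
      ((f.map (mapRingHom φ)).map (evalRingHom t)).eval y = 0 → IsIntegral ℤ ((N : ℂ) * y) := by
  classical
  obtain ⟨N, hN, hint⟩ := exists_integral_multiples ℤ ℚ
    (f.support.biUnion fun k => (f.coeff k).support.image (f.coeff k).coeff)
  have hint' : ∀ k m, IsIntegral ℤ (N • (f.coeff k).coeff m) := by
    intro k m
    by_cases h : (f.coeff k).coeff m = 0
    · rw [h, smul_zero]; exact isIntegral_zero
    · refine hint _ (Finset.mem_biUnion.2 ⟨k, ?_, Finset.mem_image.2 ⟨m, ?_, rfl⟩⟩)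
      · rw [mem_support_iff]; rintro h'; simp [h'] at h
      · rwa [mem_support_iff]
  refine ⟨N, hN, fun φ t y ht hy => ?_⟩
  set p := (f.map (mapRingHom φ)).map (evalRingHom t) with hp
  have hpm : p.Monic := (hf.map _).map _
  have hcp : ∀ k, IsIntegral ℤ ((N : ℂ) * p.coeff k) := by
    intro k
    simp only [hp, coeff_map, coe_evalRingHom, coe_mapRingHom, eval_map, eval₂_eq_sum_range,
      Finset.mul_sum, ← mul_assoc]
    refine IsIntegral.sum _ fun m _ => IsIntegral.mul ?_ (ht.pow m)
    have := (hint' k m).map φ.toIntAlgHom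
    simpa using this
  refine isIntegral_of_monic_of_coeff (scaleRoots p N) ((monic_scaleRoots_iff _).2 hpm) ?_ ?_
  · intro k
    rw [coeff_scaleRoots]
    obtain hk | hk | hk := lt_trichotomy k p.natDegree
    · obtain ⟨j, hj⟩ : ∃ j, p.natDegree - k = j + 1 := ⟨p.natDegree - k - 1, by omega⟩
      rw [hj, pow_succ, mul_left_comm, mul_comm (p.coeff k)]
      exact ((isIntegral_algebraMap (R := ℤ) (x := N)).pow j).mul (hcp k)
    · rw [hk, hpm.coeff_natDegree]; simpa using isIntegral_one
    · rw [coeff_eq_zero_of_natDegree_lt hk, zero_mul]; exact isIntegral_zero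
  · have := scaleRoots_eval₂_eq_zero (p := p) (s := (N : ℂ)) (RingHom.id ℂ) (r := y) hy
    simpa [eval₂_id] using! this

open Polynomial in
theorem sum_rootsOfUnity_mul_eval {p : ℕ} (hp : p.Prime) {ζ : ℂ} (hζ : IsPrimitiveRoot ζ p)
    (q : ℂ[X]) (hq : q.natDegree < p) (t : ℂ) {j : ℕ} (hj : j < p) :
    ∑ i ∈ Finset.range p, ζ ^ (i * (p - j)) * q.eval (ζ ^ i * t) = p * q.coeff j * t ^ j := by
  simp only [eval_eq_sum_range' hq, Finset.mul_sum]
  rw [Finset.sum_comm, Finset.sum_eq_single_of_mem j (Finset.mem_range.2 hj)]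
  · have : ∀ i ∈ Finset.range p,
        ζ ^ (i * (p - j)) * (q.coeff j * (ζ ^ i * t) ^ j) = q.coeff j * t ^ j := by
      intro i _
      have h1 : ζ ^ (i * (p - j)) * (ζ ^ i) ^ j = 1 := by
        rw [← pow_mul, ← pow_add, ← mul_add, Nat.sub_add_cancel hj.le, mul_comm, pow_mul,
          hζ.pow_eq_one, one_pow]
      rw [mul_pow]
      linear_combination (q.coeff j * t ^ j) * h1
    rw [Finset.sum_congr rfl this]
    simp [mul_assoc]
  · intro k hk hkj
    have hk' := Finset.mem_range.1 hk
    have h1 : ∀ i ∈ Finset.range p, ζ ^ (i * (p - j)) * (q.coeff k * (ζ ^ i * t) ^ k)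
        = q.coeff k * t ^ k * (ζ ^ (p - j + k)) ^ i := by
      intro i _
      rw [mul_pow, ← pow_mul ζ (p - j + k), add_mul, pow_add, ← pow_mul, mul_comm (p - j) i,
        mul_comm k i]
      ring
    rw [Finset.sum_congr rfl h1, ← Finset.mul_sum]
    have hcop : (p - j + k).Coprime p := by
      rw [Nat.coprime_comm, hp.coprime_iff_not_dvd]
      rintro ⟨c, hc⟩
      obtain hc1 | hc1 | hc1 : c = 0 ∨ c = 1 ∨ 2 ≤ c := by omega
      · subst hc1; omega
      · subst hc1; omega
      · have := Nat.mul_le_mul_left p hc1; omega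
    rw [(hζ.pow_of_coprime _ hcop).geom_sum_eq_zero hp.one_lt, mul_zero]

theorem Rat.exists_int_eq_of_isIntegral_mul_pow {p l : ℕ} (hl : l.Prime)
    {x : ℂ} (hx : x ^ p = l) {j : ℕ} (hj : j < p) {s : ℚ} (hs : IsIntegral ℤ ((s : ℂ) * x ^ j)) :
    ∃ c : ℤ, s = c := by
  have h1 : IsIntegral ℤ (algebraMap ℚ ℂ (s ^ p * l ^ j)) := by
    have := hs.pow p
    rw [mul_pow, ← pow_mul, mul_comm j p, pow_mul, hx] at this
    simpa using this
  rw [isIntegral_algebraMap_iff (algebraMap ℚ ℂ).injective,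
    IsIntegrallyClosed.isIntegral_iff] at h1
  obtain ⟨m, hm⟩ := h1
  have hd : (s.den : ℚ) ≠ 0 := by exact_mod_cast s.den_ne_zero
  have h2 : s.num ^ p * (l : ℤ) ^ j = m * (s.den : ℤ) ^ p := by
    have : (s.num : ℚ) ^ p * (l : ℚ) ^ j = m * (s.den : ℚ) ^ p := by
      rw [← Rat.num_div_den s] at hm
      simp only [eq_intCast, div_pow] at hm
      rw [hm]
      field_simp
    exact_mod_cast this
  have h3 : s.den ^ p ∣ l ^ j := by
    have h4 : (s.den : ℤ) ^ p ∣ s.num ^ p * (l : ℤ) ^ j := ⟨m, by rw [h2]; ring⟩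
    have h5 : IsCoprime ((s.den : ℤ) ^ p) (s.num ^ p) :=
      (Rat.isCoprime_num_den s).symm.pow
    exact_mod_cast h5.dvd_of_dvd_mul_left h4
  obtain ⟨k, hk, hk'⟩ := (Nat.dvd_prime_pow hl).1 h3
  have : s.den = 1 := by
    rcases Nat.eq_zero_or_pos k with h0 | h0
    · subst h0
      rw [pow_zero] at hk'
      exact (Nat.pow_eq_one.1 hk').resolve_right (by omega)
    · have : l ∣ s.den := hl.dvd_of_dvd_pow (n := p) (hk' ▸ dvd_pow_self l h0.ne')
      have h6 := (pow_dvd_pow_of_dvd this p).trans h3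
      have := (Nat.pow_dvd_pow_iff_le_right hl.one_lt).1 h6
      omega
  exact ⟨s.num, (Rat.coe_int_num_of_den_eq_one this).symm⟩

open Polynomial in
theorem eval_map_evalRingHom_map_eval {K : Type*} [CommRing K] {E : Type*} [CommRing E]
    (φ : K →+* E) (f : K[X][X]) (q : K[X]) (t : E) :
    ((f.map (mapRingHom φ)).map (evalRingHom t)).eval ((q.map φ).eval t)
      = ((f.eval q).map φ).eval t := by
  rw [map_map, eval_map, ← coe_mapRingHom φ, ← coe_evalRingHom t, ← RingHom.comp_apply,
    ← RingHom.comp_apply, eval₂_at_apply]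

open Polynomial in
/-- If `x = ℓ ^ (1 / p)` with `ℓ` a large prime, every root of a monic equation `f(x, Y) = 0` in
`K(x)` is a polynomial in `x` of degree at most `deg_X f`. -/
theorem exists_natDegree_le_of_dvd_eval {K : Type*} [Field K] [NumberField K] (f : K[X][X])
    (hf : f.Monic) (e : ℕ) (he : ∀ k, (f.coeff k).natDegree ≤ e) {p : ℕ} (hp : p.Prime) :
    ∃ l₀ : ℕ, ∀ l : ℕ, l.Prime → l₀ ≤ l → ∀ q : K[X], q.natDegree < p →
      (X ^ p - C (l : K)) ∣ f.eval q → q.natDegree ≤ e := by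
  classical
  obtain ⟨N, hN, hNint⟩ := exists_isIntegral_mul_root f hf
  have hC : ∀ φ : K →ₐ[ℚ] ℂ, ∃ C : ℝ, 0 ≤ C ∧ ∀ t y : ℂ, 1 ≤ ‖t‖ →
      ((f.map (mapRingHom (φ : K →+* ℂ))).map (evalRingHom t)).eval y = 0 →
      ‖y‖ ≤ C * ‖t‖ ^ e := fun φ =>
    exists_norm_root_le_mul_pow _ (hf.map _) e fun k => by
      rw [coeff_map, coe_mapRingHom]; exact natDegree_map_le.trans (he k)
  choose C hC0 hC using hC
  set b := NumberField.integralBasis K with hb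
  have hbint : ∀ k, IsIntegral ℤ (b k) := fun k => by
    rw [hb, NumberField.integralBasis_apply]
    exact NumberField.RingOfIntegers.isIntegral_coe _
  set A : ℝ := ∑ k, ∑ φ : K →ₐ[ℚ] ℂ, ‖φ (b k)‖ * (p * (|(N : ℝ)| * C φ)) with hA
  obtain ⟨l₀, hl₀⟩ := exists_nat_gt (A ^ p)
  refine ⟨l₀, fun l hl hll q hq hdvd => ?_⟩
  by_contra! hj
  set j := q.natDegree with hjdef
  obtain ⟨x, hx⟩ := IsAlgClosed.exists_pow_nat_eq (l : ℂ) hp.pos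
  have hxint : IsIntegral ℤ x := IsIntegral.of_pow hp.pos (by
    rw [hx]; exact_mod_cast isIntegral_algebraMap (R := ℤ) (A := ℂ) (x := l))
  have hxn : ‖x‖ ^ p = l := by rw [← norm_pow, hx]; simp
  have hx1 : 1 ≤ ‖x‖ := by
    by_contra! h
    have := pow_lt_one₀ (norm_nonneg x) h hp.ne_zero
    rw [hxn] at this
    exact absurd this (by exact_mod_cast hl.pos.ne' ∘ Nat.lt_one_iff.1)
  have hxA : A < ‖x‖ := by
    refine lt_of_pow_lt_pow_left₀ p (norm_nonneg x) ?_
    rw [hxn]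
    exact hl₀.trans_le (by exact_mod_cast hll)
  set ζ := Complex.exp (2 * Real.pi * Complex.I / p) with hζdef
  have hζ : IsPrimitiveRoot ζ p := Complex.isPrimitiveRoot_exp p hp.ne_zero
  have hζint : IsIntegral ℤ ζ := hζ.isIntegral hp.pos
  have hζn : ‖ζ‖ = 1 := hζ.norm'_eq_one hp.ne_zero
  have hroot : ∀ (φ : K →+* ℂ) (i : ℕ), ((f.map (mapRingHom φ)).map
      (evalRingHom (ζ ^ i * x))).eval ((q.map φ).eval (ζ ^ i * x)) = 0 := by
    intro φ i
    rw [eval_map_evalRingHom_map_eval]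
    obtain ⟨r, hr⟩ := hdvd
    have h1 : ζ ^ (i * p) = 1 := by rw [mul_comm, pow_mul, hζ.pow_eq_one, one_pow]
    rw [hr, Polynomial.map_mul, eval_mul]
    simp [mul_pow, ← pow_mul, h1, hx]
  have hfilter : ∀ φ : K →+* ℂ, φ (p * N * q.coeff j) * x ^ j =
      ∑ i ∈ Finset.range p, ζ ^ (i * (p - j)) * (N * (q.map φ).eval (ζ ^ i * x)) := by
    intro φ
    have := sum_rootsOfUnity_mul_eval hp hζ (q.map φ) (natDegree_map_le.trans_lt hq) x hq
    simp only [mul_left_comm _ (N : ℂ), ← Finset.mul_sum]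
    rw [this]
    simp only [map_mul, map_natCast, map_intCast, coeff_map]
    ring
  set z : K := p * N * q.coeff j with hz
  have hzint : ∀ φ : K →+* ℂ, IsIntegral ℤ (φ z * x ^ j) := by
    intro φ
    rw [hfilter]
    exact IsIntegral.sum _ fun i _ => (hζint.pow _).mul
      (hNint φ _ _ ((hζint.pow _).mul hxint) (hroot φ i))
  have hznorm : ∀ φ : K →ₐ[ℚ] ℂ, ‖φ z‖ * ‖x‖ ^ j ≤ p * (|(N : ℝ)| * C φ) * ‖x‖ ^ e := by
    intro φ
    rw [← norm_pow, ← norm_mul]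
    have := hfilter (φ : K →+* ℂ)
    rw [RingHom.coe_coe] at this
    rw [this]
    refine (norm_sum_le _ _).trans ?_
    have h1 : ∀ i ∈ Finset.range p, ‖ζ ^ (i * (p - j)) *
        (N * (q.map (φ : K →+* ℂ)).eval (ζ ^ i * x))‖ ≤ |(N : ℝ)| * C φ * ‖x‖ ^ e := by
      intro i _
      have hn : ‖ζ ^ i * x‖ = ‖x‖ := by simp [hζn]
      have := hC φ (ζ ^ i * x) _ (hn.symm ▸ hx1) (hroot φ i)
      rw [hn] at this
      rw [norm_mul, norm_mul, norm_pow, hζn, one_pow, one_mul, Complex.norm_intCast, mul_assoc]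
      gcongr
    refine (Finset.sum_le_sum h1).trans ?_
    simp [mul_assoc]
  have htr : ∀ k, Algebra.trace ℚ K (z * b k) = 0 := by
    intro k
    set s := Algebra.trace ℚ K (z * b k) with hs
    have hsum : (s : ℂ) = ∑ φ : K →ₐ[ℚ] ℂ, φ (z * b k) := by
      rw [← trace_eq_sum_embeddings ℂ]; simp [hs]
    obtain ⟨c, hc⟩ := Rat.exists_int_eq_of_isIntegral_mul_pow hl hx hq (s := s) (by
      rw [hsum, Finset.sum_mul]
      refine IsIntegral.sum _ fun φ _ => ?_
      rw [map_mul, mul_right_comm]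
      exact (hzint φ).mul ((hbint k).map (φ : K →+* ℂ).toIntAlgHom))
    have hle : ‖(s : ℂ)‖ * ‖x‖ ^ j ≤ A * ‖x‖ ^ e := by
      rw [hsum]
      calc ‖∑ φ : K →ₐ[ℚ] ℂ, φ (z * b k)‖ * ‖x‖ ^ j
          ≤ (∑ φ : K →ₐ[ℚ] ℂ, ‖φ (z * b k)‖) * ‖x‖ ^ j := by gcongr; exact norm_sum_le _ _
        _ ≤ (∑ φ : K →ₐ[ℚ] ℂ, ‖φ (b k)‖ * (p * (|(N : ℝ)| * C φ))) * ‖x‖ ^ e := by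
          rw [Finset.sum_mul, Finset.sum_mul]
          refine Finset.sum_le_sum fun φ _ => ?_
          rw [map_mul, norm_mul, mul_comm ‖φ z‖, mul_assoc, mul_assoc]
          exact mul_le_mul_of_nonneg_left (hznorm φ) (norm_nonneg _)
        _ ≤ A * ‖x‖ ^ e := by
          gcongr
          exact Finset.single_le_sum
            (f := fun k => ∑ φ : K →ₐ[ℚ] ℂ, ‖φ (b k)‖ * (p * (|(N : ℝ)| * C φ)))
            (fun k _ => Finset.sum_nonneg fun φ _ => by have := hC0 φ; positivity)
            (Finset.mem_univ k)
    have hxe : 0 < ‖x‖ ^ e := by positivity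
    have hlt : ‖(s : ℂ)‖ < 1 := by
      by_contra! h
      have h2 : ‖x‖ ^ e * ‖x‖ ≤ ‖x‖ ^ j := by
        rw [← pow_succ]; exact pow_le_pow_right₀ hx1 hj
      have h3 : ‖x‖ ^ j ≤ ‖(s : ℂ)‖ * ‖x‖ ^ j := le_mul_of_one_le_left (by positivity) h
      nlinarith
    rw [hc] at hlt ⊢
    have : |c| < 1 := by
      have : ‖((c : ℚ) : ℂ)‖ = ((|c| : ℤ) : ℝ) := by simp
      rw [this] at hlt
      exact_mod_cast hlt
    rw [Int.abs_lt_one_iff.1 this, Int.cast_zero]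
  have hz0 : z = 0 := by
    refine (traceForm_nondegenerate ℚ K).1 z fun w => ?_
    have : Algebra.traceForm ℚ K z = 0 := b.ext fun k => by
      rw [Algebra.traceForm_apply, htr, LinearMap.zero_apply]
    rw [this, LinearMap.zero_apply]
  have hqj : q.coeff j = 0 := by
    simpa [hz, hp.ne_zero, hN] using hz0
  have : q = 0 := leadingCoeff_eq_zero.1 hqj
  simp [hjdef, this] at hj

theorem NumberField.pow_ne_natCast_of_prime {K : Type*} [Field K] [NumberField K] {p l : ℕ}
    (hp : Module.finrank ℚ K < p) (hl : l.Prime) (c : K) : c ^ p ≠ l := by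
  intro h
  have h1 : Algebra.norm ℚ c ^ p = (l : ℚ) ^ Module.finrank ℚ K := by
    rw [← map_pow, h, ← Algebra.norm_algebraMap (S := K) (l : ℚ),
      map_natCast (algebraMap ℚ K)]
  have := Fact.mk hl
  have hpos := Module.finrank_pos (R := ℚ) (M := K)
  have h2 := congrArg (padicValRat l) h1
  rw [padicValRat.pow, padicValRat.pow, padicValRat.self hl.one_lt, mul_one] at h2
  have h3 : (p : ℤ) ∣ (Module.finrank ℚ K : ℤ) := ⟨_, h2.symm⟩
  exact absurd (Nat.le_of_dvd hpos (by exact_mod_cast h3)) (by omega)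

open Polynomial in
theorem natDegree_eval_le {R : Type*} [CommSemiring R] (f : R[X][X]) {e : ℕ}
    (he : ∀ k, (f.coeff k).natDegree ≤ e) {q : R[X]} (hq : q.natDegree ≤ e) :
    (f.eval q).natDegree ≤ e + f.natDegree * e := by
  rw [eval_eq_sum_range]
  refine natDegree_sum_le_of_forall_le _ _ fun k hk => natDegree_mul_le.trans ?_
  have := Finset.mem_range.1 hk
  exact add_le_add (he k) (natDegree_pow_le.trans (Nat.mul_le_mul (by omega) hq))

open Polynomial IntermediateField in
theorem exists_adjoin_simple_forall_eval_ne_zero {K Ω : Type*} [Field K] [NumberField K] [Field Ω]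
    [Algebra K Ω] [IsAlgClosed Ω] (B : Finset Ω) (hB : ∀ b ∈ B, b ∉ Set.range (algebraMap K Ω))
    {ι : Type*} [Finite ι] (f : ι → K[X][X]) (hf : ∀ i, (f i).Monic)
    (hroot : ∀ i q, (f i).eval q ≠ 0) (g : K[X]) (hg : g ≠ 0) :
    ∃ x : Ω, aeval x g ≠ 0 ∧ (∀ b ∈ B, b ∉ K⟮x⟯) ∧ ∀ i, ∀ y ∈ K⟮x⟯,
      (((f i).map (mapRingHom (algebraMap K Ω))).map (evalRingHom x)).eval y ≠ 0 := by
  classical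
  cases nonempty_fintype ι
  set e : ι → ℕ := fun i => (f i).support.sup fun k => ((f i).coeff k).natDegree with he
  have hfe : ∀ i k, ((f i).coeff k).natDegree ≤ e i := by
    intro i k
    by_cases hk : k ∈ (f i).support
    · exact Finset.le_sup (f := fun k => ((f i).coeff k).natDegree) hk
    · rw [notMem_support_iff.1 hk]; simp
  obtain ⟨p, hpge, hp⟩ := Nat.exists_infinite_primes (Module.finrank ℚ K + g.natDegree
    + ∑ i, (e i + (f i).natDegree * e i) + ∑ b ∈ B, (minpoly K b).natDegree + 1)
  choose l₀ hl₀ using fun i => exists_natDegree_le_of_dvd_eval (f i) (hf i) (e i) (hfe i) hp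
  obtain ⟨l, hlge, hl⟩ := Nat.exists_infinite_primes (∑ i, l₀ i)
  have hirr : Irreducible (X ^ p - C (l : K)) :=
    X_pow_sub_C_irreducible_of_prime hp (NumberField.pow_ne_natCast_of_prime (by omega) hl)
  obtain ⟨x, hx⟩ := IsAlgClosed.exists_pow_nat_eq (l : Ω) hp.pos
  have hmin : minpoly K x = X ^ p - C (l : K) :=
    (minpoly.eq_of_irreducible_of_monic hirr (by simp [hx]) (monic_X_pow_sub_C _ hp.ne_zero)).symm
  have hdeg : (minpoly K x).natDegree = p := by rw [hmin, natDegree_X_pow_sub_C]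
  have hxint : IsIntegral K x := minpoly.ne_zero_iff.1 fun h => by
    rw [h] at hdeg; exact hp.ne_zero hdeg.symm
  have hfin : Module.finrank K K⟮x⟯ = p := by rw [adjoin.finrank hxint, hdeg]
  have := adjoin.finiteDimensional hxint
  refine ⟨x, fun h => ?_, fun b hb hbx => ?_, fun i y hy h => ?_⟩
  · have := natDegree_le_of_dvd (minpoly.dvd K x h) hg
    omega
  · have hbint : IsIntegral K (⟨b, hbx⟩ : K⟮x⟯) := Algebra.IsIntegral.isIntegral _
    have hd := minpoly.degree_dvd hbint
    rw [hfin, show minpoly K (⟨b, hbx⟩ : K⟮x⟯) = minpoly K b from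
      (minpoly.algebraMap_eq (algebraMap K⟮x⟯ Ω).injective _).symm] at hd
    have hlt := Finset.single_le_sum (f := fun b => (minpoly K b).natDegree)
      (fun _ _ => Nat.zero_le _) hb
    rcases (Nat.dvd_prime hp).1 hd with h1 | h1
    · exact hB b hb (minpoly.natDegree_eq_one_iff.1 h1)
    · omega
  · have hq : ∃ q : K[X], q.natDegree < p ∧ aeval x q = y := by
      rw [← mem_toSubalgebra, adjoin_simple_toSubalgebra_of_isAlgebraic hxint.isAlgebraic,
        Algebra.adjoin_singleton_eq_range_aeval] at hy
      obtain ⟨r, rfl⟩ := hy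
      have hm : (minpoly K x).Monic := minpoly.monic hxint
      refine ⟨r %ₘ minpoly K x, ?_, aeval_modByMonic_eq_self_of_root (minpoly.aeval K x)⟩
      rw [← hdeg]
      exact natDegree_modByMonic_lt _ hm (minpoly.ne_one K x)
    obtain ⟨q, hqp, rfl⟩ := hq
    rw [← eval_map_algebraMap, eval_map_evalRingHom_map_eval, eval_map_algebraMap] at h
    have hdvd := minpoly.dvd K x h
    have hqe := hl₀ i l hl (le_trans (Finset.single_le_sum (f := l₀) (fun _ _ => Nat.zero_le _)
      (Finset.mem_univ i)) hlge) q hqp (hmin ▸ hdvd)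
    have h1 := natDegree_le_of_dvd hdvd (hroot i q)
    have h2 := natDegree_eval_le (f i) (hfe i) hqe
    have h3 := Finset.single_le_sum (f := fun i => e i + (f i).natDegree * e i)
      (fun _ _ => Nat.zero_le _) (Finset.mem_univ i)
    omega

open Polynomial in
theorem exists_map_mapRingHom_eq {K L : Type*} [CommRing K] [CommRing L] (φ : K →+* L)
    (f : L[X][X]) (h : ∀ j k, (f.coeff j).coeff k ∈ Set.range φ) :
    ∃ f' : K[X][X], f'.map (mapRingHom φ) = f := by
  refine (mem_lifts f).1 ((lifts_iff_coeff_lifts f).2 fun j => ?_)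
  exact (mem_lifts _).1 ((lifts_iff_coeff_lifts _).2 (h j))

open Polynomial in
theorem eval_map_evalRingHom_map {K L : Type*} [CommRing K] [CommRing L] (φ : K →+* L)
    (f : K[X][X]) (x y : K) :
    ((f.map (mapRingHom φ)).map (evalRingHom (φ x))).eval (φ y)
      = φ ((f.map (evalRingHom x)).eval y) := by
  rw [map_map, eval_map, eval_map, hom_eval₂]
  congr 1
  ext <;> simp

open Polynomial in
theorem Irreducible.eval_ne_zero_of_two_le_natDegree {R : Type*} [CommRing R] [IsDomain R]
    {f : R[X]} (hf : Irreducible f) (hd : 2 ≤ f.natDegree) (a : R) : f.eval a ≠ 0 := by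
  intro h
  obtain ⟨r, hr⟩ := dvd_iff_isRoot.2 h
  rcases hf.isUnit_or_isUnit hr with hu | hu
  · exact (not_isUnit_X_sub_C a) hu
  · have h0 : r ≠ 0 := hu.ne_zero
    rw [hr, natDegree_mul (X_sub_C_ne_zero a) h0, natDegree_X_sub_C,
      natDegree_eq_zero_of_isUnit hu] at hd
    omega

instance : Algebra.IsAlgebraic ℚ Qbar := by
  have h : (DivisionRing.toRatAlgebra : Algebra ℚ Qbar) = AlgebraicClosure.instAlgebra ℚ :=
    Subsingleton.elim _ _
  rw [h]
  exact AlgebraicClosure.isAlgebraic ℚ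

instance : Countable Qbar := by
  rw [← Cardinal.mk_le_aleph0_iff]
  simpa using Algebra.IsAlgebraic.cardinalMk_le_max ℚ Qbar

instance {R : Type*} [Semiring R] [Countable R] : Countable (Polynomial R) := by
  rw [← Cardinal.mk_le_aleph0_iff]
  simpa using Polynomial.cardinalMk_le_max (R := R)

open Classical in
/-- The indicator function of a subfield of `Q̄`. -/
def subfieldIndicator (F : Subfield Qbar) (a : Qbar) : Bool := decide (a ∈ F)

theorem isInducing_subfieldIndicator : IsInducing subfieldIndicator := by
  classical
  constructor
  have h1 : propDiscrete = TopologicalSpace.induced (fun P : Prop => decide P) ⊥ := by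
    refine le_antisymm bot_le fun s _ => ⟨(fun P : Prop => decide P) '' s, trivial, ?_⟩
    exact Set.preimage_image_eq _ fun P Q h => by simpa using h
  have h2 : powersetTopology = TopologicalSpace.induced
      (fun (S : Qbar → Prop) (a : Qbar) => decide (S a)) Pi.topologicalSpace := by
    change (⨅ _, _) = TopologicalSpace.induced _ (⨅ _, _)
    simp only [induced_iInf, induced_compose, h1]
    rfl
  change TopologicalSpace.induced _ powersetTopology = _
  rw [h2]
  exact induced_compose

theorem isClopen_setOf_mem (a : Qbar) : IsClopen {F : Subfield Qbar | a ∈ F} := by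
  have h := (isClopen_discrete {true}).preimage
    ((continuous_apply a).comp isInducing_subfieldIndicator.continuous)
  convert h using 1
  ext F
  simp [subfieldIndicator]

theorem isClosedEmbedding_subfieldIndicator : IsClosedEmbedding subfieldIndicator := by
  refine ⟨⟨isInducing_subfieldIndicator, fun F G h => ?_⟩, ?_⟩
  · ext a
    simpa [subfieldIndicator] using congrFun h a
  · have hc : ∀ a, IsClopen {s : Qbar → Bool | s a = true} := fun a =>
      (isClopen_discrete {true}).preimage (continuous_apply a)
    have : Set.range subfieldIndicator = {s | s 1 = true} ∩ {s | s 0 = true} ∩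
        (⋂ a, ⋂ b, {s | s a = true → s b = true → s (a * b) = true}) ∩
        (⋂ a, ⋂ b, {s | s a = true → s b = true → s (a + b) = true}) ∩
        (⋂ a, {s | s a = true → s (-a) = true}) ∩ (⋂ a, {s | s a = true → s a⁻¹ = true}) := by
      ext s
      simp only [Set.mem_range, Set.mem_inter_iff, Set.mem_iInter, Set.mem_ofPred_eq]
      constructor
      · rintro ⟨F, rfl⟩
        simp only [subfieldIndicator, decide_eq_true_eq]
        exact ⟨⟨⟨⟨⟨F.one_mem, F.zero_mem⟩, fun _ _ => F.mul_mem⟩, fun _ _ => F.add_mem⟩,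
          fun _ => F.neg_mem⟩, fun _ => F.inv_mem⟩
      · rintro ⟨⟨⟨⟨⟨h1, h0⟩, hm⟩, ha⟩, hn⟩, hi⟩
        let F : Subfield Qbar :=
          { carrier := {a | s a = true}
            one_mem' := h1
            zero_mem' := h0
            mul_mem' := hm _ _
            add_mem' := ha _ _
            neg_mem' := hn _
            inv_mem' := hi }
        refine ⟨F, funext fun a => ?_⟩
        have : a ∈ F ↔ s a = true := Iff.rfl
        simp [subfieldIndicator, this]
    rw [this]
    refine (((((hc 1).isClosed.inter (hc 0).isClosed).inter ?_).inter ?_).inter ?_).inter ?_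
    · exact isClosed_iInter fun a => isClosed_iInter fun b =>
        isClosed_imp (hc a).isOpen (isClosed_imp (hc b).isOpen (hc _).isClosed)
    · exact isClosed_iInter fun a => isClosed_iInter fun b =>
        isClosed_imp (hc a).isOpen (isClosed_imp (hc b).isOpen (hc _).isClosed)
    · exact isClosed_iInter fun a => isClosed_imp (hc a).isOpen (hc _).isClosed
    · exact isClosed_iInter fun a => isClosed_imp (hc a).isOpen (hc _).isClosed

instance : CompactSpace (Subfield Qbar) := isClosedEmbedding_subfieldIndicator.compactSpace

instance : T2Space (Subfield Qbar) := isClosedEmbedding_subfieldIndicator.isEmbedding.t2Space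

theorem exists_finset_of_isOpen_of_mem {V : Set (Subfield Qbar)} (hV : IsOpen V)
    {F : Subfield Qbar} (hF : F ∈ V) :
    ∃ A B : Finset Qbar, (∀ a ∈ A, a ∈ F) ∧ (∀ b ∈ B, b ∉ F) ∧
      ∀ G : Subfield Qbar, (∀ a ∈ A, a ∈ G) → (∀ b ∈ B, b ∉ G) → G ∈ V := by
  classical
  obtain ⟨W, hW, rfl⟩ := isInducing_subfieldIndicator.isOpen_iff.1 hV
  obtain ⟨I, u, hu, hIW⟩ := isOpen_pi_iff.1 hW _ hF
  refine ⟨I.filter (· ∈ F), I.filter (· ∉ F), by simp, by simp, fun G hA hB => hIW ?_⟩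
  intro a ha
  have : subfieldIndicator G a = subfieldIndicator F a := by
    by_cases h : a ∈ F
    · simp [subfieldIndicator, h, hA a (Finset.mem_filter.2 ⟨ha, h⟩)]
    · simp [subfieldIndicator, h, hB a (Finset.mem_filter.2 ⟨ha, h⟩)]
  rw [this]
  exact (hu a ha).2

open Polynomial in
/-- The subfields of `Q̄` that satisfy the Hilbertian condition for the polynomials `f i` and `g`,
or do not contain all of their coefficients. -/
def hilbertianFor {ι : Type*} (f : ι → Qbar[X][X]) (g : Qbar[X]) : Set (Subfield Qbar) :=
  {F | (∀ i j k, ((f i).coeff j).coeff k ∈ F) → (∀ k, g.coeff k ∈ F) →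
    ∃ x ∈ F, g.eval x ≠ 0 ∧ ∀ i, ∀ y ∈ F, ((f i).map (evalRingHom x)).eval y ≠ 0}

open Polynomial in
theorem isOpen_hilbertianFor {ι : Type*} [Finite ι] (f : ι → Qbar[X][X]) (g : Qbar[X])
    (hf : ∀ i, (f i).Monic) : IsOpen (hilbertianFor f g) := by
  have h : hilbertianFor f g = (⋃ i, ⋃ j, ⋃ k, {F | ((f i).coeff j).coeff k ∈ F}ᶜ) ∪
      (⋃ k, {F | g.coeff k ∈ F}ᶜ) ∪ ⋃ x, ⋃ _ : g.eval x ≠ 0, {F | x ∈ F} ∩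
        ⋂ i, ⋂ y ∈ ((f i).map (evalRingHom x)).rootSet Qbar, {F | y ∈ F}ᶜ := by
    ext F
    have hne : ∀ i (x : Qbar), (f i).map (evalRingHom x) ≠ 0 := fun i x => ((hf i).map _).ne_zero
    simp only [hilbertianFor, Set.mem_ofPred_eq, Set.mem_union, Set.mem_iUnion, Set.mem_compl_iff,
      Set.mem_inter_iff, Set.mem_iInter, mem_rootSet, coe_aeval_eq_eval, exists_prop]
    constructor
    · intro h
      by_cases h1 : ∀ i j k, ((f i).coeff j).coeff k ∈ F
      · by_cases h2 : ∀ k, g.coeff k ∈ F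
        · obtain ⟨x, hx, hg, hr⟩ := h h1 h2
          exact Or.inr ⟨x, hg, hx, fun i y hy hyF => hr i y hyF hy.2⟩
        · exact Or.inl (Or.inr (by simpa using h2))
      · exact Or.inl (Or.inl (by simpa using h1))
    · rintro ((⟨i, j, k, h⟩ | ⟨k, h⟩) | ⟨x, hg, hx, hr⟩) h1 h2
      · exact absurd (h1 i j k) h
      · exact absurd (h2 k) h
      · exact ⟨x, hx, hg, fun i y hyF hy => hr i y ⟨hne i x, hy⟩ hyF⟩
  have ho : ∀ a : Qbar, IsOpen {F : Subfield Qbar | a ∈ F}ᶜ := fun a =>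
    (isClopen_setOf_mem a).compl.isOpen
  rw [h]
  refine ((isOpen_iUnion fun i => isOpen_iUnion fun j => isOpen_iUnion fun k => ho _).union
    (isOpen_iUnion fun k => ho _)).union (isOpen_iUnion fun x => isOpen_iUnion fun _ =>
      (isClopen_setOf_mem x).isOpen.inter (isOpen_iInter_of_finite fun i => ?_))
  exact (rootSet_finite _ _).isOpen_biInter fun y _ => ho y

open Polynomial IntermediateField in
theorem dense_hilbertianFor {ι : Type*} [Finite ι] (f : ι → Qbar[X][X]) (g : Qbar[X])
    (hirr : ∀ i, Irreducible (f i)) (hf : ∀ i, (f i).Monic) (hd : ∀ i, 2 ≤ (f i).natDegree)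
    (hg : g ≠ 0) : Dense (hilbertianFor f g) := by
  rw [dense_iff_inter_open]
  rintro V hV ⟨F₀, hF₀⟩
  obtain ⟨A, B, hA, hB, hAB⟩ := exists_finset_of_isOpen_of_mem hV hF₀
  set K : IntermediateField ℚ Qbar := adjoin ℚ (A : Set Qbar) with hK
  have hAK : ∀ a ∈ A, a ∈ K := fun a ha => subset_adjoin ℚ _ ha
  have hKF : ∀ a ∈ K, a ∈ F₀ := by
    intro a ha
    have : K ≤ Subfield.toIntermediateField F₀ fun q => by
        simp :=
      adjoin_le_iff.2 hA
    exact this ha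
  have : FiniteDimensional ℚ K :=
    finiteDimensional_adjoin fun a _ => Algebra.IsIntegral.isIntegral a
  have : NumberField K := ⟨⟩
  by_cases hcoef : (∀ i j k, ((f i).coeff j).coeff k ∈ K) ∧ ∀ k, g.coeff k ∈ K
  · choose f' hf' using fun i => exists_map_mapRingHom_eq (algebraMap K Qbar) (f i)
      fun j k => ⟨⟨_, hcoef.1 i j k⟩, rfl⟩
    obtain ⟨g', hg'⟩ := (mem_lifts g).1 ((lifts_iff_coeff_lifts (f := algebraMap K Qbar) g).2
      fun k => ⟨⟨_, hcoef.2 k⟩, rfl⟩)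
    have hinj : Function.Injective (mapRingHom (algebraMap K Qbar)) :=
      map_injective _ (algebraMap K Qbar).injective
    obtain ⟨x, hxg, hxB, hxf⟩ := exists_adjoin_simple_forall_eval_ne_zero B
      (fun b hb => by rintro ⟨c, rfl⟩; exact hB _ hb (hKF _ c.2)) f'
      (fun i => (hinj.monic_map_iff).2 (by rw [hf']; exact hf i))
      (fun i q hq => (hirr i).eval_ne_zero_of_two_le_natDegree (hd i)
        (mapRingHom (algebraMap K Qbar) q) (by rw [← hf' i, eval_map, eval₂_at_apply, hq, map_zero]))
      g' (by rintro rfl; exact hg (by rw [← hg', Polynomial.map_zero]))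
    refine ⟨K⟮x⟯.toSubfield, hAB _ (fun a ha => ?_) hxB, fun _ _ => ⟨x, ?_, ?_, fun i y hy => ?_⟩⟩
    · exact K⟮x⟯.algebraMap_mem ⟨a, hAK a ha⟩
    · exact mem_adjoin_simple_self K x
    · rwa [← hg', eval_map_algebraMap]
    · rw [← hf' i]; exact hxf i y hy
  · exact ⟨K.toSubfield, hAB _ hAK fun b hb hbK => hB b hb (hKF b hbK),
      fun h1 h2 => absurd ⟨h1, h2⟩ hcoef⟩

open Polynomial in
theorem isHilbertian_iff (F : Subfield Qbar) : IsHilbertian F ↔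
    ∀ (n : ℕ), 0 < n → ∀ (f : Fin n → Qbar[X][X]) (g : Qbar[X]), (∀ i, Irreducible (f i)) →
      (∀ i, (f i).Monic) → (∀ i, 2 ≤ (f i).natDegree) → g ≠ 0 → F ∈ hilbertianFor f g := by
  have hF : Function.Injective F.subtype := F.subtype.injective
  have hinj : Function.Injective (mapRingHom F.subtype) := map_injective _ hF
  constructor
  · intro h n hn f g hirr hf hd hg hfF hgF
    choose f' hf' using fun i => exists_map_mapRingHom_eq F.subtype (f i)
      fun j k => ⟨⟨_, hfF i j k⟩, rfl⟩
    obtain ⟨g', rfl⟩ := (mem_lifts g).1 ((lifts_iff_coeff_lifts (f := F.subtype) g).2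
      fun k => ⟨⟨_, hgF k⟩, rfl⟩)
    obtain rfl : (fun i => (f' i).map (mapRingHom F.subtype)) = f := funext hf'
    obtain ⟨x, hx, hr⟩ := h n hn f' g' hirr (fun i => hinj.monic_map_iff.2 (hf i))
      (fun i => by simpa only [natDegree_map_eq_of_injective hinj] using hd i)
      (by rintro rfl; exact hg (Polynomial.map_zero _))
    refine ⟨x, x.2, ?_, fun i y hy => ?_⟩
    · have := (map_ne_zero_iff F.subtype hF).2 hx
      rwa [← eval₂_at_apply, ← eval_map] at this
    · have := (map_ne_zero_iff F.subtype hF).2 (hr i ⟨y, hy⟩)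
      rwa [← eval_map_evalRingHom_map] at this
  · intro h n hn f g hirr hf hd hg
    obtain ⟨x, hx, hgx, hr⟩ := h n hn (fun i => (f i).map (mapRingHom F.subtype))
      (g.map F.subtype) hirr (fun i => (hf i).map _)
      (fun i => by simpa only [natDegree_map_eq_of_injective hinj] using hd i)
      ((Polynomial.map_ne_zero_iff hF).2 hg) (fun i j k => by simp) (fun k => by simp)
    refine ⟨⟨x, hx⟩, fun h0 => hgx ?_, fun i y h0 => hr i y y.2 ?_⟩
    · have := eval₂_at_apply (p := g) F.subtype ⟨x, hx⟩
      rw [h0, map_zero, ← eval_map] at this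
      exact this
    · have := eval_map_evalRingHom_map F.subtype (f i) ⟨x, hx⟩ y
      rw [h0, map_zero] at this
      exact this

open Polynomial in
theorem setOf_isHilbertian_eq_iInter : {F : Subfield Qbar | IsHilbertian F} =
    ⋂ d : {d : Σ n, (Fin n → Qbar[X][X]) × Qbar[X] // 0 < d.1 ∧ (∀ i, Irreducible (d.2.1 i)) ∧
      (∀ i, (d.2.1 i).Monic) ∧ (∀ i, 2 ≤ (d.2.1 i).natDegree) ∧ d.2.2 ≠ 0},
      hilbertianFor d.1.2.1 d.1.2.2 := by
  ext F
  rw [Set.mem_ofPred_eq, isHilbertian_iff, Set.mem_iInter]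
  constructor
  · rintro h ⟨⟨n, f, g⟩, hn, hirr, hf, hd, hg⟩
    exact h n hn f g hirr hf hd hg
  · intro h n hn f g hirr hf hd hg
    exact h ⟨⟨n, f, g⟩, hn, hirr, hf, hd, hg⟩

/-- The set of Hilbertian subfields of `Q̄` is a dense `G_δ` subset, in particular a
comeager subset, of the space `𝓔` of all subfields of `Q̄`. -/
theorem hilbertian_dense_Gdelta :
    Dense {F : Subfield Qbar | IsHilbertian F} ∧ IsGδ {F : Subfield Qbar | IsHilbertian F} ∧
      {F : Subfield Qbar | IsHilbertian F} ∈ residual (Subfield Qbar) := by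
  have hdense : Dense {F : Subfield Qbar | IsHilbertian F} := by
    rw [setOf_isHilbertian_eq_iInter]
    exact dense_iInter_of_isOpen (fun d => isOpen_hilbertianFor _ _ d.2.2.2.1)
      fun d => dense_hilbertianFor _ _ d.2.2.1 d.2.2.2.1 d.2.2.2.2.1 d.2.2.2.2.2
  have hGδ : IsGδ {F : Subfield Qbar | IsHilbertian F} := by
    rw [setOf_isHilbertian_eq_iInter]
    exact IsGδ.iInter_of_isOpen fun d => isOpen_hilbertianFor _ _ d.2.2.2.1
  exact ⟨hdense, hGδ, residual_of_dense_Gδ hGδ hdense⟩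
end
end

section
/- The set of subfields F of the algebraic closure of ℚ that are Hilbertian is dense in the space 𝓔 of all subfields of the algebraic closure of ℚ. -/
open FirstOrder Topology

noncomputable section

section Hilbertian

open Polynomial

theorem card_maximalSpectrum_le {S : Type*} [CommRing S] [Finite S] {p μ : ℕ} [Fact p.Prime]
    [CharP S p] (hS : Nat.card S = p ^ μ) : Nat.card (MaximalSpectrum S) ≤ μ := by
  have hp : p.Prime := Fact.out
  have hsurj : Function.Surjective
      ((IsArtinianRing.quotNilradicalEquivPi S) ∘ (Ideal.Quotient.mk (nilradical S))) :=
    (IsArtinianRing.quotNilradicalEquivPi S).surjective.comp Ideal.Quotient.mk_surjective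
  have : Finite (MaximalSpectrum S) := inferInstance
  have := Fintype.ofFinite (MaximalSpectrum S)
  have h1 := Nat.card_le_card_of_surjective _ hsurj
  rw [Nat.card_pi, hS] at h1
  have h2 : ∀ I : MaximalSpectrum S, p ≤ Nat.card (S ⧸ I.asIdeal) := by
    intro I
    let : Algebra (ZMod p) S := ZMod.algebra S p
    have := I.isMaximal
    have : Nontrivial (S ⧸ I.asIdeal) := Ideal.Quotient.nontrivial_iff.2 I.isMaximal.ne_top
    have : Finite (S ⧸ I.asIdeal) := Finite.of_surjective _ Ideal.Quotient.mk_surjective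
    have := Nat.card_le_card_of_injective _ (algebraMap (ZMod p) (S ⧸ I.asIdeal)).injective
    rwa [Nat.card_zmod] at this
  have h3 := (Finset.prod_le_prod' fun I (_ : I ∈ Finset.univ) => h2 I).trans h1
  rw [Finset.prod_const, Finset.card_univ, ← Nat.card_eq_fintype_card] at h3
  exact (Nat.pow_le_pow_iff_right hp.one_lt).1 h3

/-- Two roots of `P` with nilpotent difference agree if the derivative of `P` is invertible at an
approximate root. -/
theorem eq_of_isNilpotent_sub {S : Type*} [CommRing S] {P : S[X]} {a y z : S}
    (hP : IsNilpotent (P.eval a)) (hP' : IsUnit (P.derivative.eval a))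
    (hy : P.eval y = 0) (hz : P.eval z = 0) (hay : IsNilpotent (a - y))
    (haz : IsNilpotent (a - z)) : y = z :=
  (existsUnique_nilpotent_sub_and_aeval_eq_zero (P := P) (x := a)
    (by simpa using hP) (by simpa using hP')).unique ⟨hay, by simpa using hy⟩ ⟨haz, by simpa using hz⟩

theorem card_roots_le_pow {S : Type*} [CommRing S] [Finite S] {p μ : ℕ} [Fact p.Prime]
    [CharP S p] (hS : Nat.card S = p ^ μ) {P : S[X]} (hP : P.Monic) (hd : 0 < P.natDegree) :
    {a | P.eval a = 0 ∧ IsUnit (P.derivative.eval a)}.ncard ≤ P.natDegree ^ μ := by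
  classical
  have hmax := card_maximalSpectrum_le hS
  have := Fintype.ofFinite (MaximalSpectrum S)
  let (I : MaximalSpectrum S) : Field (S ⧸ I.asIdeal) :=
    have := I.isMaximal
    Ideal.Quotient.field I.asIdeal
  let T (I : MaximalSpectrum S) : Finset (S ⧸ I.asIdeal) :=
    (P.map (Ideal.Quotient.mk I.asIdeal)).roots.toFinset
  have hT (I : MaximalSpectrum S) : (T I).card ≤ P.natDegree :=
    (Multiset.toFinset_card_le _).trans ((card_roots' _).trans natDegree_map_le)
  have hcard : (Fintype.piFinset T).card ≤ P.natDegree ^ μ := by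
    rw [Fintype.card_piFinset]
    refine (Finset.prod_le_prod' fun I _ => hT I).trans ?_
    rw [Finset.prod_const, Finset.card_univ, ← Nat.card_eq_fintype_card]
    exact Nat.pow_le_pow_right hd hmax
  refine le_trans ?_ hcard
  rw [← Set.ncard_coe_finset]
  refine Set.ncard_le_ncard_of_injOn (fun a I => Ideal.Quotient.mk I.asIdeal a) ?_ ?_
    (Finset.finite_toSet _)
  · rintro a ⟨ha, -⟩
    simp only [Finset.mem_coe, Fintype.mem_piFinset, T, Multiset.mem_toFinset]
    intro I
    rw [mem_roots (hP.map _).ne_zero, IsRoot, eval_map, eval₂_at_apply, ha, map_zero]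
  · rintro a ⟨ha, ha'⟩ c ⟨hc, -⟩ hac
    have hnil : IsNilpotent (a - c) := by
      rw [← mem_nilradical, IsArtinianRing.nilradical_eq_iInf, Ideal.mem_iInf]
      intro I
      exact Ideal.Quotient.eq.1 (congrFun hac I)
    exact eq_of_isNilpotent_sub (a := a) (by simp [ha]) ha' ha hc (by simp) hnil

section Box

variable {R ι : Type*} [CommRing R] [Fintype ι]

/-- The linear combination of a `ℤ`-basis with digits `c` in `{0, …, n - 1}`. -/
noncomputable def digitSum (b : Module.Basis ι ℤ R) {n : ℕ} (c : ι → Fin n) : R :=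
  ∑ k, ((c k : ℕ) : R) * b k

theorem digitSum_injective (b : Module.Basis ι ℤ R) (n : ℕ) :
    Function.Injective (digitSum b : (ι → Fin n) → R) := by
  intro c c' h
  have h2 (c : ι → Fin n) : b.equivFun.symm (fun k => ((c k : ℕ) : ℤ)) = digitSum b c := by
    simp [digitSum, Module.Basis.equivFun_symm_apply, zsmul_eq_mul]
  rw [← h2, ← h2, EmbeddingLike.apply_eq_iff_eq] at h
  funext k
  simpa [Fin.ext_iff] using congrFun h k

theorem exists_digitSum (b : Module.Basis ι ℤ R) {n : ℕ} (hn : 0 < n) (r : R) :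
    ∃ (c : ι → Fin n) (t : R), r = digitSum b c + n * t := by
  have hn' : (0 : ℤ) < n := by exact_mod_cast hn
  refine ⟨fun k => ⟨(b.repr r k % n).toNat, ?_⟩, ∑ k, (b.repr r k / n : ℤ) • b k, ?_⟩
  · have := Int.emod_lt_of_pos (b.repr r k) hn'
    have := Int.emod_nonneg (b.repr r k) hn'.ne'
    omega
  · conv_lhs => rw [← b.sum_repr r]
    rw [digitSum, Finset.mul_sum, ← Finset.sum_add_distrib]
    refine Finset.sum_congr rfl fun k _ => ?_
    have h1 : ((b.repr r k % n).toNat : ℤ) = b.repr r k % n :=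
      Int.toNat_of_nonneg (Int.emod_nonneg _ hn'.ne')
    have h2 : (((b.repr r k % n).toNat : ℕ) : R) = ((b.repr r k % n : ℤ) : R) := by
      rw [← h1]; push_cast; rfl
    rw [h2, zsmul_eq_mul, zsmul_eq_mul, ← mul_assoc, ← add_mul]
    congr 1
    conv_lhs => rw [← Int.emod_add_mul_ediv (b.repr r k) n]
    push_cast; ring

theorem card_pi_digits (p : ℕ) {a : ℕ} (e : Fin a → ℕ) :
    Nat.card (∀ i, ι → Fin (p ^ e i)) = p ^ ((∑ i, e i) * Fintype.card ι) := by
  simp [Nat.card_pi, ← pow_mul, Finset.prod_pow_eq_pow_sum, Finset.sum_mul]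

/-- The ideal `(p, X - x)ᵐ` of `R[X]`. -/
noncomputable abbrev localIdeal (p : ℕ) (x : R) (m : ℕ) : Ideal R[X] :=
  Ideal.span {(p : R[X]), X - C x} ^ m

theorem exists_surjective_digits (b : Module.Basis ι ℤ R) {p : ℕ} (hp : 0 < p) (x : R) (m : ℕ) :
    ∃ Φ : (∀ i : Fin m, ι → Fin (p ^ (m - i))) → R[X] ⧸ localIdeal p x m,
      Function.Surjective Φ := by
  refine ⟨fun c => Ideal.Quotient.mk _ (∑ i, C (digitSum b (c i)) * (X - C x) ^ (i : ℕ)), ?_⟩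
  intro q
  obtain ⟨q, rfl⟩ := Ideal.Quotient.mk_surjective q
  have hmem (i j : ℕ) (hij : m ≤ i + j) : (p : R[X]) ^ i * (X - C x) ^ j ∈ localIdeal p x m := by
    refine Ideal.pow_le_pow_right hij ?_
    rw [pow_add]
    exact Ideal.mul_mem_mul (Ideal.pow_mem_pow (Ideal.subset_span (by simp)) _)
      (Ideal.pow_mem_pow (Ideal.subset_span (by simp)) _)
  choose c t hct using fun i : Fin m =>
    exists_digitSum b (pow_pos hp (m - i)) ((taylor x q).coeff i)
  refine ⟨c, ?_⟩
  symm
  rw [Ideal.Quotient.eq]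
  have hq : q = ∑ i ∈ Finset.range (m + (taylor x q).natDegree + 1),
      C ((taylor x q).coeff i) * (X - C x) ^ i := by
    conv_lhs => rw [← sum_taylor_eq q x]
    exact sum_over_range' _ (fun _ => by simp) _ (by omega)
  rw [← Fin.sum_univ_eq_sum_range
    (fun i => C ((taylor x q).coeff i) * (X - C x) ^ i), add_assoc, Fin.sum_univ_add] at hq
  rw [hq, add_sub_right_comm, ← Finset.sum_sub_distrib]
  refine add_mem (sum_mem fun i _ => ?_) (sum_mem fun i _ => ?_)
  · have : C ((taylor x q).coeff (i : ℕ)) * (X - C x) ^ (i : ℕ)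
        - C (digitSum b (c i)) * (X - C x) ^ (i : ℕ)
        = C (t i) * ((p : R[X]) ^ (m - i) * (X - C x) ^ (i : ℕ)) := by
      rw [hct i]; simp; ring
    simp only [Fin.val_castAdd]
    rw [this]
    exact Ideal.mul_mem_left _ _ (hmem _ _ (by omega))
  · refine Ideal.mul_mem_left _ _ ?_
    simpa using hmem 0 _ (by simp)

theorem sum_tsub_fin (m : ℕ) : 2 * ∑ i : Fin m, (m - i) = m * (m + 1) := by
  rw [Fin.sum_univ_eq_sum_range (fun i => m - i)]
  have h := Finset.sum_range_reflect (fun i => i + 1) m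
  have h2 : ∑ i ∈ Finset.range m, (m - i) = ∑ j ∈ Finset.range m, (m - 1 - j + 1) :=
    Finset.sum_congr rfl fun i hi => by have := Finset.mem_range.1 hi; omega
  rw [h2, h, Finset.sum_add_distrib, mul_add]
  have := Finset.sum_range_id_mul_two m
  rw [mul_comm 2, this]
  cases m with
  | zero => simp
  | succ k => simp; ring

end Box

section LocalBranch

variable {R : Type*} [CommRing R]

/-- The implicit function theorem modulo `(p, X - x₀)ᵐ`: at an étale point `(x₀, y₀)` modulo `p`
the coordinate `Y` is given by a function `η` of `X` alone, up to an error divisible by `pᵐ`. -/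
theorem exists_localBranch {p : ℕ} (m : ℕ) (f : R[X][X]) (x₀ y₀ v : R)
    (h0 : (p : R) ∣ f.evalEval x₀ y₀) (h1 : (p : R) ∣ f.derivative.evalEval x₀ y₀ * v - 1) :
    ∃ η : R[X] ⧸ localIdeal p x₀ m, ∀ x y : R, f.evalEval x y = 0 → (p : R) ∣ x - x₀ →
      (p : R) ∣ y - y₀ → ∀ g₀ g₁ : R[X],
      Ideal.Quotient.mk (localIdeal p x₀ m) g₀ + Ideal.Quotient.mk (localIdeal p x₀ m) g₁ * η = 0 →
      (p : R) ^ m ∣ g₀.eval x + g₁.eval x * y := by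
  set J : Ideal R[X] := Ideal.span {(p : R[X]), X - C x₀} with hJ
  set Q := R[X] ⧸ localIdeal p x₀ m
  set π : R[X] →+* Q := Ideal.Quotient.mk (localIdeal p x₀ m) with hπ
  have hJmem (g : R[X]) (hg : (p : R) ∣ g.eval x₀) : g ∈ J := by
    obtain ⟨t, ht⟩ := hg
    obtain ⟨q, hq⟩ := X_sub_C_dvd_sub_C_eval (p := g) (a := x₀)
    rw [ht, sub_eq_iff_eq_add] at hq
    rw [hq, C_mul]
    refine add_mem (Ideal.mul_mem_right _ _ (Ideal.subset_span (by simp)))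
      (Ideal.mul_mem_right _ _ (Ideal.subset_span (by simp)))
  have hnil (g : R[X]) (hg : g ∈ J) : IsNilpotent (π g) :=
    ⟨m, by rw [← map_pow, hπ, Ideal.Quotient.eq_zero_iff_mem]; exact Ideal.pow_mem_pow hg m⟩
  have hev (h : R[X][X]) : (h.map π).eval (π (C y₀)) = π (h.eval (C y₀)) := by
    rw [eval_map, eval₂_at_apply]
  have hA : IsNilpotent ((f.map π).eval (π (C y₀))) := by
    rw [hev]
    exact hnil _ (hJmem _ h0)
  have hB : IsUnit ((f.map π).derivative.eval (π (C y₀))) := by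
    rw [derivative_map, hev]
    have : IsUnit (π (f.derivative.eval (C y₀) * C v)) := by
      have h2 : IsNilpotent (π (f.derivative.eval (C y₀) * C v - 1)) :=
        hnil _ (hJmem _ (by simpa using h1))
      have := h2.isUnit_one_add
      simpa using this
    rw [map_mul] at this
    exact isUnit_of_mul_isUnit_left this
  obtain ⟨η, ⟨hη1, hη2⟩, -⟩ := existsUnique_nilpotent_sub_and_aeval_eq_zero
    (P := f.map π) (x := π (C y₀)) (by simpa using hA) (by simpa using hB)
  simp only [coe_aeval_eq_eval] at hη2
  refine ⟨η, fun x y hxy hx hy g₀ g₁ hg => ?_⟩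
  let ρ : R →+* R ⧸ Ideal.span {(p : R) ^ m} := Ideal.Quotient.mk _
  have hρ (r : R) (hr : (p : R) ∣ r) : IsNilpotent (ρ r) :=
    ⟨m, by
      rw [← map_pow, Ideal.Quotient.eq_zero_iff_mem, Ideal.mem_span_singleton]
      exact pow_dvd_pow_of_dvd hr m⟩
  have hle : ∀ g ∈ localIdeal p x₀ m, (ρ.comp (evalRingHom x)) g = 0 := by
    intro g hg
    have h2 : J.map (evalRingHom x) ≤ Ideal.span {(p : R)} := by
      rw [hJ, Ideal.map_span, Ideal.span_le]
      rintro _ ⟨g, hg, rfl⟩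
      rcases hg with rfl | rfl
      · simp
      · simpa [Ideal.mem_span_singleton] using hx
    have h3 := Ideal.mem_map_of_mem (evalRingHom x) hg
    rw [Ideal.map_pow] at h3
    have h4 := Ideal.pow_right_mono h2 m h3
    rw [Ideal.span_singleton_pow] at h4
    exact Ideal.Quotient.eq_zero_iff_mem.2 h4
  let ε : Q →+* R ⧸ Ideal.span {(p : R) ^ m} :=
    Ideal.Quotient.lift (localIdeal p x₀ m) (ρ.comp (evalRingHom x)) hle
  have hε (g : R[X]) : ε (π g) = ρ (g.eval x) := Ideal.Quotient.lift_mk _ _ _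
  have hεπ : ε.comp π = ρ.comp (evalRingHom x) := RingHom.ext hε
  let P : (R ⧸ Ideal.span {(p : R) ^ m})[X] := f.map (ρ.comp (evalRingHom x))
  have hP (h : R[X][X]) (y : R) :
      (h.map (ρ.comp (evalRingHom x))).eval (ρ y) = ρ (h.evalEval x y) := by
    rw [← map_map, eval_map, eval₂_at_apply, map_evalRingHom_eval]
  have hP' (q : Q) : P.eval (ε q) = ε ((f.map π).eval q) := by
    rw [← eval₂_at_apply, ← eval_map, map_map, hεπ]
  have hεy : ε (π (C y₀)) = ρ y₀ := by rw [hε, eval_C]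
  have key : ρ y = ε η := by
    refine eq_of_isNilpotent_sub (P := P) (a := ρ y₀) ?_ ?_ ?_ ?_ ?_ ?_
    · rw [← hεy, hP']; exact hA.map ε
    · rw [derivative_map] at hB ⊢
      have h5 := hB.map ε
      rw [← eval₂_at_apply, ← eval_map, map_map, hεπ, hεy] at h5
      exact h5
    · rw [hP, hxy, map_zero]
    · rw [hP', hη2, map_zero]
    · rw [← map_sub]; exact hρ _ (by rwa [← dvd_neg, neg_sub])
    · rw [← hεy, ← map_sub]; exact hη1.map ε
  have h6 := congrArg ε hg
  rw [map_add, map_mul, hε, hε, ← key, map_zero, ← map_mul, ← map_add,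
    Ideal.Quotient.eq_zero_iff_mem, Ideal.mem_span_singleton] at h6
  exact h6

/-- Pigeonhole principle: points of the curve `f = 0` in an étale residue class modulo `p` satisfy
modulo `pᵐ` an equation that is linear in `Y` and has small coefficients. -/
theorem exists_auxiliary {ι : Type*} [Fintype ι] [Nonempty ι] (b : Module.Basis ι ℤ R) {p : ℕ}
    (hp : 1 < p) (m : ℕ) {A B : ℕ} (e : Fin A → ℕ) (e' : Fin B → ℕ)
    (hcount : m * (m + 1) < 2 * (∑ i, e i + ∑ i, e' i))
    (f : R[X][X]) (x₀ y₀ v : R)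
    (h0 : (p : R) ∣ f.evalEval x₀ y₀) (h1 : (p : R) ∣ f.derivative.evalEval x₀ y₀ * v - 1) :
    ∃ (c c' : ∀ i, ι → Fin (p ^ e i)) (d d' : ∀ i, ι → Fin (p ^ e' i)), (c, d) ≠ (c', d') ∧
      ∀ x y : R, f.evalEval x y = 0 → (p : R) ∣ x - x₀ → (p : R) ∣ y - y₀ →
      (p : R) ^ m ∣ ∑ i : Fin A, (digitSum b (c i) - digitSum b (c' i)) * x ^ (i : ℕ) +
        (∑ i : Fin B, (digitSum b (d i) - digitSum b (d' i)) * x ^ (i : ℕ)) * y := by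
  obtain ⟨η, hη⟩ := exists_localBranch m f x₀ y₀ v h0 h1
  obtain ⟨Φ, hΦ⟩ := exists_surjective_digits b (zero_lt_one.trans hp) x₀ m
  have : Finite (R[X] ⧸ localIdeal p x₀ m) := Finite.of_surjective _ hΦ
  have hc := Nat.card_le_card_of_surjective _ hΦ
  rw [card_pi_digits] at hc
  let G (c : ∀ i, ι → Fin (p ^ e i)) : R[X] := ∑ i : Fin A, C (digitSum b (c i)) * X ^ (i : ℕ)
  let G' (c : ∀ i, ι → Fin (p ^ e' i)) : R[X] := ∑ i : Fin B, C (digitSum b (c i)) * X ^ (i : ℕ)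
  let Ψ : (∀ i, ι → Fin (p ^ e i)) × (∀ i, ι → Fin (p ^ e' i)) → R[X] ⧸ localIdeal p x₀ m :=
    fun z => Ideal.Quotient.mk _ (G z.1) + Ideal.Quotient.mk _ (G' z.2) * η
  have hninj : ¬ Function.Injective Ψ := by
    intro hinj
    have h2 := (Nat.card_le_card_of_injective _ hinj).trans hc
    rw [Nat.card_prod, card_pi_digits, card_pi_digits, ← pow_add, ← add_mul] at h2
    have h3 := (Nat.pow_le_pow_iff_right hp).1 h2
    have h4 := Nat.le_of_mul_le_mul_right h3 Fintype.card_pos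
    have h5 := sum_tsub_fin m
    omega
  simp only [Function.Injective, not_forall] at hninj
  obtain ⟨⟨c, d⟩, ⟨c', d'⟩, hcd, hne⟩ := hninj
  refine ⟨c, c', d, d', hne, fun x y hxy hx hy => ?_⟩
  have h6 := hη x y hxy hx hy (G c - G c') (G' d - G' d') (by
    rw [map_sub, map_sub, sub_mul]
    simp only [Ψ] at hcd
    linear_combination hcd)
  have h7 (c c' : ∀ i, ι → Fin (p ^ e i)) : (G c - G c').eval x =
      ∑ i : Fin A, (digitSum b (c i) - digitSum b (c' i)) * x ^ (i : ℕ) := by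
    simp [G, eval_finsetSum, sub_mul]
  have h8 (c c' : ∀ i, ι → Fin (p ^ e' i)) : (G' c - G' c').eval x =
      ∑ i : Fin B, (digitSum b (c i) - digitSum b (c' i)) * x ^ (i : ℕ) := by
    simp [G', eval_finsetSum, sub_mul]
  rwa [h7, h8] at h6

end LocalBranch

section Size

open NumberField

variable {K : Type*} [Field K] [NumberField K]

theorem norm_eval_natCast_le (q : (𝓞 K)[X]) {D : ℕ} (hq : q.natDegree ≤ D) {B : ℝ}
    (hB : 1 ≤ B) {x : ℕ} (hx : (x : ℝ) ≤ B) (σ : K →+* ℂ) :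
    ‖σ (q.eval (x : 𝓞 K) : 𝓞 K)‖ ≤ (∑ i ∈ Finset.range (D + 1), house (q.coeff i : K)) * B ^ D := by
  rw [eval_eq_sum_range' (Nat.lt_succ_of_le hq), Finset.sum_mul]
  push_cast
  rw [map_sum]
  refine (norm_sum_le _ _).trans (Finset.sum_le_sum fun i hi => ?_)
  rw [map_mul, norm_mul, map_pow, map_natCast, norm_pow, Complex.norm_natCast]
  have hi' : i ≤ D := Nat.lt_succ_iff.1 (Finset.mem_range.1 hi)
  have h1 : (x : ℝ) ^ i ≤ B ^ D :=
    (pow_le_pow_left₀ (by positivity) hx i).trans (pow_le_pow_right₀ hB hi')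
  exact mul_le_mul (norm_embedding_le_house _ _) h1 (by positivity) (house_nonneg _)

theorem exists_norm_root_le (f : (𝓞 K)[X][X]) (hf : f.Monic) {D : ℕ}
    (hD : ∀ j, (f.coeff j).natDegree ≤ D) :
    ∃ M : ℝ, 1 ≤ M ∧ ∀ (B : ℝ) (x : ℕ) (y : 𝓞 K), 1 ≤ B → (x : ℝ) ≤ B → f.evalEval (x : 𝓞 K) y = 0 →
      ∀ σ : K →+* ℂ, ‖σ y‖ ≤ M * B ^ D := by
  set M₀ := ∑ j ∈ Finset.range f.natDegree,
    ∑ i ∈ Finset.range (D + 1), house ((f.coeff j).coeff i : K) with hM₀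
  have hM0 : 0 ≤ M₀ := Finset.sum_nonneg fun j _ => Finset.sum_nonneg fun i _ => house_nonneg _
  refine ⟨M₀ + 1, by linarith, fun B x y hB hx hxy σ => ?_⟩
  have hBD : 1 ≤ B ^ D := one_le_pow₀ hB
  rw [← map_evalRingHom_eval] at hxy
  set P : (𝓞 K)[X] := f.map (evalRingHom (x : 𝓞 K)) with hP
  have hPm : P.Monic := hf.map _
  set τ : 𝓞 K →+* ℂ := σ.comp (algebraMap (𝓞 K) K)
  have hroot : (P.map τ).IsRoot (σ y) := by
    have : σ y = τ y := rfl
    rw [this, IsRoot, eval_map, eval₂_at_apply, hxy, map_zero]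
  have h1 := hroot.norm_lt_cauchyBound (hPm.map τ).ne_zero
  rw [cauchyBound, (hPm.map τ).leadingCoeff, nnnorm_one, div_one] at h1
  have hpos : 0 ≤ M₀ * B ^ D := by positivity
  have h2 : ((Finset.range (P.map τ).natDegree).sup (‖(P.map τ).coeff ·‖₊) : NNReal) ≤
      (M₀ * B ^ D).toNNReal := by
    refine Finset.sup_le fun j hj => ?_
    rw [hPm.natDegree_map, hP, hf.natDegree_map] at hj
    refine NNReal.coe_le_coe.1 ?_
    rw [coe_nnnorm, Real.coe_toNNReal _ hpos, coeff_map, hP, coeff_map]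
    refine (norm_eval_natCast_le (f.coeff j) (hD j) hB hx σ).trans ?_
    refine mul_le_mul_of_nonneg_right ?_ (by positivity)
    exact Finset.single_le_sum (f := fun j => ∑ i ∈ Finset.range (D + 1),
      house ((f.coeff j).coeff i : K)) (fun j _ => Finset.sum_nonneg fun i _ => house_nonneg _) hj
  have h3 := NNReal.coe_le_coe.2 (h1.le.trans (add_le_add_left h2 1))
  rw [coe_nnnorm, NNReal.coe_add, Real.coe_toNNReal _ hpos, NNReal.coe_one] at h3
  linarith

theorem norm_digitSum_sub_le {ι : Type*} [Fintype ι] (b : Module.Basis ι ℤ (𝓞 K)) {n : ℕ}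
    (c c' : ι → Fin n) (σ : K →+* ℂ) :
    ‖σ (digitSum b c - digitSum b c' : 𝓞 K)‖ ≤ (∑ k, house (b k : K)) * n := by
  rw [digitSum, digitSum, ← Finset.sum_sub_distrib, Finset.sum_mul]
  push_cast
  rw [map_sum]
  refine (norm_sum_le _ _).trans (Finset.sum_le_sum fun k _ => ?_)
  rw [← sub_mul, map_mul, norm_mul, mul_comm, map_sub, map_natCast, map_natCast]
  refine mul_le_mul (norm_embedding_le_house _ _) ?_ (norm_nonneg _) (house_nonneg _)
  have h1 := (c k).2
  have h2 := (c' k).2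
  have h3 : ((c k : ℕ) : ℂ) - ((c' k : ℕ) : ℂ) = (((c k : ℕ) : ℝ) - ((c' k : ℕ) : ℝ) : ℝ) := by
    push_cast; ring
  rw [h3, Complex.norm_real, Real.norm_eq_abs, abs_le]
  have h4 : ((c k : ℕ) : ℝ) ≤ n := by exact_mod_cast h1.le
  have h5 : ((c' k : ℕ) : ℝ) ≤ n := by exact_mod_cast h2.le
  have h6 : (0 : ℝ) ≤ ((c k : ℕ) : ℝ) := by positivity
  have h7 : (0 : ℝ) ≤ ((c' k : ℕ) : ℝ) := by positivity
  constructor <;> linarith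

theorem eq_zero_of_dvd_of_norm_lt {n : ℕ} {z : 𝓞 K} (hz : (n : 𝓞 K) ∣ z)
    (h : ∀ σ : K →+* ℂ, ‖σ z‖ < n) : z = 0 := by
  obtain ⟨t, rfl⟩ := hz
  by_contra hne
  obtain ⟨σ, hσ⟩ := exists_conjugate_one_le_norm (right_ne_zero_of_mul hne)
  have h1 := h σ
  push_cast at h1
  rw [map_mul, norm_mul, map_natCast, Complex.norm_natCast] at h1
  have : (n : ℝ) * 1 ≤ n * ‖σ t‖ := mul_le_mul_of_nonneg_left hσ (by positivity)
  linarith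

/-- The auxiliary equations vanish exactly at points of bounded size once `p` is large. -/
theorem exists_forall_auxiliary_eq_zero {ι : Type*} [Fintype ι] (b : Module.Basis ι ℤ (𝓞 K))
    {M : ℝ} (hM : 1 ≤ M) (D : ℕ) {L : ℕ} (hL : 1 ≤ L) :
    ∃ p₀ : ℕ, ∀ p, p₀ < p → ∀ (c c' : ∀ i : Fin (5 * D), ι → Fin (p ^ (9 * D - 1 - i)))
      (d d' : ∀ i : Fin (4 * D), ι → Fin (p ^ (8 * D - 1 - i))) (x : ℕ) (y : 𝓞 K), x ≤ L * p →
      (∀ σ : K →+* ℂ, ‖σ y‖ ≤ M * (L * p) ^ D) →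
      (p : 𝓞 K) ^ (9 * D) ∣
        ∑ i : Fin (5 * D), (digitSum b (c i) - digitSum b (c' i)) * (x : 𝓞 K) ^ (i : ℕ) +
        (∑ i : Fin (4 * D), (digitSum b (d i) - digitSum b (d' i)) * (x : 𝓞 K) ^ (i : ℕ)) * y →
      ∑ i : Fin (5 * D), (digitSum b (c i) - digitSum b (c' i)) * (x : 𝓞 K) ^ (i : ℕ) +
        (∑ i : Fin (4 * D), (digitSum b (d i) - digitSum b (d' i)) * (x : 𝓞 K) ^ (i : ℕ)) * y
        = 0 := by
  set β : ℝ := ∑ k, house (b k : K) with hβ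
  have hβ0 : 0 ≤ β := Finset.sum_nonneg fun k _ => house_nonneg _
  obtain ⟨p₀, hp₀⟩ := exists_nat_gt (9 * D * (β * (M * L ^ (9 * D))))
  refine ⟨p₀, fun p hp c c' d d' x y hx hy hdvd => ?_⟩
  have hL' : (1 : ℝ) ≤ L := by exact_mod_cast hL
  have hp1 : (1 : ℝ) ≤ p := by exact_mod_cast (by omega : 1 ≤ p)
  have hp' : 9 * D * (β * (M * L ^ (9 * D))) < (p : ℝ) := hp₀.trans (by exact_mod_cast hp)
  have hx' : (x : ℝ) ≤ L * p := by exact_mod_cast hx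
  rcases Nat.eq_zero_or_pos D with rfl | hDpos
  · simp
  refine eq_zero_of_dvd_of_norm_lt (n := p ^ (9 * D)) (by exact_mod_cast hdvd) fun σ => ?_
  have hterm {n k i : ℕ} (h : n + k + i = 9 * D - 1) (c c' : ι → Fin (p ^ n)) {z : ℝ} (hz0 : 0 ≤ z)
      (hz : z ≤ M * (L * p) ^ k) :
      ‖σ ((digitSum b c - digitSum b c' : 𝓞 K) * (x : K) ^ i)‖ * z ≤
        β * (M * L ^ (9 * D)) * p ^ (9 * D - 1) := by
    rw [map_mul, norm_mul, map_pow, map_natCast, norm_pow, Complex.norm_natCast]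
    calc ‖σ (digitSum b c - digitSum b c' : 𝓞 K)‖ * (x : ℝ) ^ i * z
        ≤ (β * (p ^ n : ℕ)) * (L * p) ^ i * (M * (L * p) ^ k) := by
          gcongr
          exact norm_digitSum_sub_le b c c' σ
      _ = β * (M * L ^ (i + k)) * p ^ (n + k + i) := by push_cast; ring
      _ ≤ β * (M * L ^ (9 * D)) * p ^ (9 * D - 1) := by
          rw [h]
          gcongr
          omega
  have h1 : ‖σ ((∑ i : Fin (5 * D), (digitSum b (c i) - digitSum b (c' i)) *
      (x : 𝓞 K) ^ (i : ℕ) : 𝓞 K) : K)‖ ≤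
        5 * D * (β * (M * L ^ (9 * D)) * p ^ (9 * D - 1)) := by
    push_cast
    rw [map_sum]
    refine (norm_sum_le _ _).trans ?_
    refine (Finset.sum_le_card_nsmul _ _ (β * (M * L ^ (9 * D)) * p ^ (9 * D - 1))
      fun i _ => ?_).trans ?_
    · have := hterm (n := 9 * D - 1 - i) (k := 0) (i := i) (by omega) (c i) (c' i) zero_le_one
        (by simpa using hM)
      simpa using this
    · simp
  have h2 : ‖σ (((∑ i : Fin (4 * D), (digitSum b (d i) - digitSum b (d' i)) *
      (x : 𝓞 K) ^ (i : ℕ)) * y : 𝓞 K) : K)‖ ≤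
        4 * D * (β * (M * L ^ (9 * D)) * p ^ (9 * D - 1)) := by
    push_cast
    rw [map_mul, map_sum, norm_mul]
    refine (mul_le_mul_of_nonneg_right (norm_sum_le _ _) (norm_nonneg _)).trans ?_
    rw [Finset.sum_mul]
    refine (Finset.sum_le_card_nsmul _ _ (β * (M * L ^ (9 * D)) * p ^ (9 * D - 1))
      fun i _ => ?_).trans ?_
    · have := hterm (n := 8 * D - 1 - i) (k := D) (i := i) (by omega) (d i) (d' i) (norm_nonneg _)
        (hy σ)
      simpa using this
    · simp
  push_cast at h1 h2 ⊢
  rw [map_add]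
  refine (norm_add_le _ _).trans_lt ?_
  have h3 : (p : ℝ) ^ (9 * D) = p * p ^ (9 * D - 1) := by
    rw [← pow_succ']; congr 1; omega
  rw [h3]
  have h4 : (0 : ℝ) < p ^ (9 * D - 1) := by positivity
  calc _ ≤ 5 * D * (β * (M * L ^ (9 * D)) * p ^ (9 * D - 1)) +
        4 * D * (β * (M * L ^ (9 * D)) * p ^ (9 * D - 1)) := add_le_add h1 h2
    _ = 9 * D * (β * (M * L ^ (9 * D))) * p ^ (9 * D - 1) := by ring
    _ < _ := mul_lt_mul_of_pos_right hp' h4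

end Size

section Elimination

variable {R : Type*} [CommRing R]

/-- The numerator of `f(X, -g₀ / g₁)`, i.e. the polynomial obtained by eliminating `Y` from `f = 0`
and `g₀ + g₁ Y = 0`. -/
noncomputable def elimination (f : R[X][X]) (g₀ g₁ : R[X]) : R[X] :=
  ∑ j ∈ Finset.range (f.natDegree + 1), f.coeff j * (-g₀) ^ j * g₁ ^ (f.natDegree - j)

theorem natDegree_elimination_le {f : R[X][X]} {g₀ g₁ : R[X]} {D E : ℕ}
    (hD : ∀ j, (f.coeff j).natDegree ≤ D) (h₀ : g₀.natDegree ≤ E) (h₁ : g₁.natDegree ≤ E) :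
    (elimination f g₀ g₁).natDegree ≤ D + f.natDegree * E := by
  refine natDegree_sum_le_of_forall_le _ _ fun j hj => ?_
  have hj' : j ≤ f.natDegree := Nat.lt_succ_iff.1 (Finset.mem_range.1 hj)
  have h2 : ((-g₀) ^ j).natDegree ≤ j * E := natDegree_pow_le_of_le j (by rwa [natDegree_neg])
  have h3 : (g₁ ^ (f.natDegree - j)).natDegree ≤ (f.natDegree - j) * E := natDegree_pow_le_of_le _ h₁
  refine (natDegree_mul_le_of_le (natDegree_mul_le_of_le (hD j) h2) h3).trans ?_
  rw [add_assoc, ← add_mul, Nat.add_sub_cancel' hj']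

theorem eval_elimination_eq_zero {f : R[X][X]} {g₀ g₁ : R[X]} {x y : R}
    (hf : f.evalEval x y = 0) (hg : g₀.eval x + g₁.eval x * y = 0) :
    (elimination f g₀ g₁).eval x = 0 := by
  have h0 : -g₀.eval x = g₁.eval x * y := by linear_combination -hg
  rw [← map_evalRingHom_eval, eval_map, eval₂_eq_sum_range] at hf
  rw [elimination, eval_finsetSum]
  trans (g₁.eval x) ^ f.natDegree *
    ∑ i ∈ Finset.range (f.natDegree + 1), evalRingHom x (f.coeff i) * y ^ i
  · rw [Finset.mul_sum]
    refine Finset.sum_congr rfl fun j hj => ?_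
    have hj' : j ≤ f.natDegree := Nat.lt_succ_iff.1 (Finset.mem_range.1 hj)
    have h4 : g₁.eval x ^ f.natDegree = g₁.eval x ^ j * g₁.eval x ^ (f.natDegree - j) := by
      rw [← pow_add, Nat.add_sub_cancel' hj']
    rw [h4]
    simp only [eval_mul, eval_pow, eval_neg, h0, coe_evalRingHom, mul_pow]
    ring
  · rw [hf, mul_zero]

theorem elimination_ne_zero [IsDomain R] {f : R[X][X]} (hf : f.Monic)
    (hroot : ∀ φ : FractionRing R[X], f.eval₂ (algebraMap R[X] (FractionRing R[X])) φ ≠ 0)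
    {g₀ g₁ : R[X]} (hg : g₀ ≠ 0 ∨ g₁ ≠ 0) : elimination f g₀ g₁ ≠ 0 := by
  intro h
  by_cases h1 : g₁ = 0
  · subst h1
    have h0 : g₀ ≠ 0 := by simpa using hg
    rw [elimination, Finset.sum_range_succ, Finset.sum_eq_zero] at h
    · simp [hf, h0] at h
    · intro j hj
      have := Finset.mem_range.1 hj
      rw [zero_pow (by omega), mul_zero]
  · set F := FractionRing R[X]
    set α := algebraMap R[X] F
    have hα : α g₁ ≠ 0 := by
      simpa [α] using h1
    apply hroot (-α g₀ / α g₁)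
    have h2 := congrArg α h
    rw [elimination, map_sum, map_zero] at h2
    rw [eval₂_eq_sum_range]
    have h3 : α g₁ ^ f.natDegree * ∑ i ∈ Finset.range (f.natDegree + 1),
        α (f.coeff i) * (-α g₀ / α g₁) ^ i = 0 := by
      rw [← h2, Finset.mul_sum]
      refine Finset.sum_congr rfl fun j hj => ?_
      have hj' : j ≤ f.natDegree := Nat.lt_succ_iff.1 (Finset.mem_range.1 hj)
      have h4 : α g₁ ^ f.natDegree = α g₁ ^ j * α g₁ ^ (f.natDegree - j) := by
        rw [← pow_add, Nat.add_sub_cancel' hj']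
      rw [h4, div_pow]
      simp only [map_mul, map_pow, map_neg]
      have h5 : α g₁ ^ j ≠ 0 := pow_ne_zero _ hα
      rw [mul_comm (α g₁ ^ j), mul_assoc, mul_left_comm _ (α (f.coeff j)), mul_div_cancel₀ _ h5]
      ring
    exact (mul_eq_zero.1 h3).resolve_left (pow_ne_zero _ hα)

end Elimination

section Residues

theorem card_filter_dvd_eval_le {Δ : ℤ[X]} {p : ℕ} [Fact p.Prime] (L : ℕ)
    (hΔ : ¬ (p : ℤ) ∣ Δ.leadingCoeff) :
    ((Finset.range (L * p)).filter fun x : ℕ => (p : ℤ) ∣ Δ.eval (x : ℤ)).card ≤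
      L * Δ.natDegree := by
  classical
  have hp : p.Prime := Fact.out
  set Δ' : (ZMod p)[X] := Δ.map (Int.castRingHom (ZMod p)) with hΔ'
  have hne : Δ' ≠ 0 := by
    intro h
    apply hΔ
    have := congrArg (fun q => coeff q Δ.natDegree) h
    simp only [hΔ', coeff_map, coeff_zero] at this
    exact (ZMod.intCast_zmod_eq_zero_iff_dvd _ _).1 this |>.trans (by simp)
  refine (Finset.card_le_mul_card_image_of_maps_to (f := fun x : ℕ => (x : ZMod p))
    (t := Δ'.roots.toFinset) ?_ L ?_).trans (Nat.mul_le_mul_left L ?_)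
  · intro x hx
    rw [Finset.mem_filter] at hx
    rw [Multiset.mem_toFinset, mem_roots hne, IsRoot, hΔ', eval_map]
    have h1 : ((x : ℕ) : ZMod p) = Int.castRingHom (ZMod p) (x : ℤ) := by simp
    rw [h1, eval₂_at_apply]
    exact (ZMod.intCast_zmod_eq_zero_iff_dvd _ _).2 hx.2
  · intro r _
    refine (Finset.card_le_card_of_injOn (t := Finset.range L) (fun x => x / p) ?_ ?_).trans_eq
      (Finset.card_range L)
    · intro x hx
      simp only [Finset.coe_filter, Finset.mem_filter, Finset.mem_range, Set.mem_ofPred_eq] at hx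
      simpa using Nat.div_lt_of_lt_mul (by rw [mul_comm]; exact hx.1.1)
    · intro x hx z hz hxz
      simp only [Finset.coe_filter, Finset.mem_filter, Finset.mem_range, Set.mem_ofPred_eq] at hx hz
      have h2 : x % p = z % p := (ZMod.natCast_eq_natCast_iff x z p).1 (hx.2.trans hz.2.symm)
      simp only at hxz
      rw [← Nat.div_add_mod x p, ← Nat.div_add_mod z p, hxz, h2]
  · exact (Multiset.toFinset_card_le _).trans ((card_roots' _).trans natDegree_map_le)

theorem charP_of_card_eq_pow {S : Type*} [CommRing S] [Finite S] {p μ : ℕ} (hp : p.Prime)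
    (hμ : 0 < μ) (hS : Nat.card S = p ^ μ) (h0 : (p : S) = 0) : CharP S p := by
  have : Nontrivial S := by
    rw [← Finite.one_lt_card_iff_nontrivial, hS]
    exact Nat.one_lt_pow hμ.ne' hp.one_lt
  exact (CharP.charP_iff_prime_eq_zero hp).2 h0

end Residues

section Counting

open NumberField

theorem two_mul_sum_tsub {n m : ℕ} (h : n ≤ m) :
    2 * ∑ i : Fin n, (m - 1 - i) + n * (n + 1) = 2 * m * n := by
  rw [Fin.sum_univ_eq_sum_range (fun i => m - 1 - i)]
  induction n with
  | zero => simp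
  | succ k ih =>
    rw [Finset.sum_range_succ]
    have := ih (by omega)
    obtain ⟨t, rfl⟩ := Nat.exists_eq_add_of_le h
    have h2 : k + 1 + t - 1 - k = t := by omega
    rw [h2]
    linarith

theorem exponents_count {D : ℕ} (hD : 1 ≤ D) :
    9 * D * (9 * D + 1) < 2 * (∑ i : Fin (5 * D), (9 * D - 1 - i) +
      ∑ i : Fin (4 * D), (8 * D - 1 - i)) := by
  have h1 := two_mul_sum_tsub (show 5 * D ≤ 9 * D by omega)
  have h2 := two_mul_sum_tsub (show 4 * D ≤ 8 * D by omega)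
  nlinarith

theorem digits_polynomial_ne_zero {R ι : Type*} [CommRing R] [Fintype ι]
    (b : Module.Basis ι ℤ R) {p n : ℕ} (e : Fin n → ℕ) {c c' : ∀ i, ι → Fin (p ^ e i)}
    (h : c ≠ c') :
    (∑ i : Fin n, C (digitSum b (c i) - digitSum b (c' i)) * X ^ (i : ℕ) : R[X]) ≠ 0 := by
  intro h0
  apply h
  funext i
  have h1 := congrArg (fun q => coeff q (i : ℕ)) h0
  simp only [finsetSum_coeff, coeff_C_mul, coeff_X_pow, coeff_zero] at h1
  rw [Finset.sum_eq_single i] at h1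
  · simp only [if_true, mul_one] at h1
    exact digitSum_injective b _ (sub_eq_zero.1 h1)
  · intro j _ hj
    rw [if_neg (fun h => hj (Fin.ext h.symm)), mul_zero]
  · simp

theorem natDegree_digits_polynomial_le {R : Type*} [CommRing R] {n : ℕ} (c : Fin n → R) :
    (∑ i : Fin n, C (c i) * X ^ (i : ℕ) : R[X]).natDegree ≤ n :=
  natDegree_sum_le_of_forall_le _ _ fun i _ => (natDegree_C_mul_X_pow_le _ _).trans i.2.le

variable {K : Type*} [Field K] [NumberField K]

/-- In an étale residue class modulo a large prime `p`, the curve `f = 0` has boundedly many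
integral points whose first coordinate is a natural number below `L * p`. -/
theorem exists_card_class_le (f : (𝓞 K)[X][X]) (hf : f.Monic)
    (hroot : ∀ φ : FractionRing (𝓞 K)[X],
      f.eval₂ (algebraMap (𝓞 K)[X] (FractionRing (𝓞 K)[X])) φ ≠ 0) :
    ∃ E : ℕ, ∀ L, 1 ≤ L → ∃ p₀ : ℕ, ∀ p, p₀ < p → 1 < p → ∀ (x₀ y₀ v : 𝓞 K),
      (p : 𝓞 K) ∣ f.evalEval x₀ y₀ → (p : 𝓞 K) ∣ f.derivative.evalEval x₀ y₀ * v - 1 →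
      ∀ s : Finset ℕ, (∀ x ∈ s, x < L * p ∧ ∃ y, f.evalEval (x : 𝓞 K) y = 0 ∧
        (p : 𝓞 K) ∣ (x : 𝓞 K) - x₀ ∧ (p : 𝓞 K) ∣ y - y₀) → s.card ≤ E := by
  classical
  obtain ⟨D, hD1, hD⟩ : ∃ D, 1 ≤ D ∧ ∀ j, (f.coeff j).natDegree ≤ D := by
    refine ⟨f.support.sup (fun j => (f.coeff j).natDegree) + 1, by omega, fun j => ?_⟩
    by_cases hj : j ∈ f.support
    · exact (Finset.le_sup (f := fun j => (f.coeff j).natDegree) hj).trans (Nat.le_succ _)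
    · simp [notMem_support_iff.1 hj]
  obtain ⟨M, hM1, hM⟩ := exists_norm_root_le f hf hD
  let b := RingOfIntegers.basis K
  refine ⟨D + f.natDegree * (5 * D), fun L hL => ?_⟩
  obtain ⟨p₀, hp₀⟩ := exists_forall_auxiliary_eq_zero b hM1 D hL
  refine ⟨p₀, fun p hp hp1 x₀ y₀ v h0 h1 s hs => ?_⟩
  obtain ⟨c, c', d, d', hne, haux⟩ := exists_auxiliary b hp1 (9 * D)
    (fun i : Fin (5 * D) => 9 * D - 1 - i) (fun i : Fin (4 * D) => 8 * D - 1 - i)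
    (exponents_count hD1) f x₀ y₀ v h0 h1
  set g₀ : (𝓞 K)[X] := ∑ i : Fin (5 * D), C (digitSum b (c i) - digitSum b (c' i)) * X ^ (i : ℕ)
  set g₁ : (𝓞 K)[X] := ∑ i : Fin (4 * D), C (digitSum b (d i) - digitSum b (d' i)) * X ^ (i : ℕ)
  have hg : g₀ ≠ 0 ∨ g₁ ≠ 0 := by
    by_cases hc : c = c'
    · exact Or.inr (digits_polynomial_ne_zero b _ fun hd => hne (by rw [hc, hd]))
    · exact Or.inl (digits_polynomial_ne_zero b _ hc)
  have hr := elimination_ne_zero hf hroot hg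
  have hrdeg : (elimination f g₀ g₁).natDegree ≤ D + f.natDegree * (5 * D) :=
    natDegree_elimination_le hD (natDegree_digits_polynomial_le _)
      ((natDegree_digits_polynomial_le _).trans (by omega))
  have hcard := Finset.card_le_card_of_injOn (s := s) (t := (elimination f g₀ g₁).roots.toFinset)
    (fun x => (x : 𝓞 K)) ?_ ?_
  · exact hcard.trans ((Multiset.toFinset_card_le _).trans ((card_roots' _).trans hrdeg))
  · intro x hx
    obtain ⟨hxL, y, hxy, hxx, hyy⟩ := hs x hx
    rw [Finset.mem_coe, Multiset.mem_toFinset, mem_roots hr, IsRoot]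
    refine eval_elimination_eq_zero hxy ?_
    have hLp : (1 : ℝ) ≤ L * p := by
      exact_mod_cast (Nat.mul_pos hL (by omega) : 0 < L * p)
    have := hp₀ p hp c c' d d' x y hxL.le
      (hM (L * p) x y hLp (by exact_mod_cast hxL.le) hxy) (haux x y hxy hxx hyy)
    simpa [g₀, g₁, eval_finsetSum] using this
  · exact fun x _ z _ h => Nat.cast_injective h

/-- The natural numbers below `L * p` at which `f` acquires an integral root number at most `c * p`,
with `c` independent of `L`. -/
theorem exists_card_filter_root_le (f : (𝓞 K)[X][X]) (hf : f.Monic) (hdeg : 0 < f.natDegree)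
    (hroot : ∀ φ : FractionRing (𝓞 K)[X],
      f.eval₂ (algebraMap (𝓞 K)[X] (FractionRing (𝓞 K)[X])) φ ≠ 0)
    {Δ : ℤ[X]} (hΔ0 : Δ ≠ 0) {u v : (𝓞 K)[X][X]}
    (hΔ : u * f + v * f.derivative = C (Δ.map (Int.castRingHom (𝓞 K)))) :
    ∃ c : ℕ, ∀ L, 1 ≤ L → ∃ p₀ : ℕ, ∀ p, p₀ < p → p.Prime → ∀ s : Finset ℕ,
      (∀ x ∈ s, x < L * p ∧ ∃ y, f.evalEval (x : 𝓞 K) y = 0) → s.card ≤ c * p := by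
  classical
  obtain ⟨E, hE⟩ := exists_card_class_le f hf hroot
  set μ := Module.finrank ℚ K with hμ
  refine ⟨1 + E * f.natDegree ^ μ, fun L hL => ?_⟩
  obtain ⟨p₀, hp₀⟩ := hE L hL
  refine ⟨p₀ + L * Δ.natDegree + Δ.leadingCoeff.natAbs, fun p hp hpp s hs => ?_⟩
  have : Fact p.Prime := ⟨hpp⟩
  have hlead : ¬ (p : ℤ) ∣ Δ.leadingCoeff := by
    intro h
    have := Nat.le_of_dvd (Int.natAbs_pos.2 (leadingCoeff_ne_zero.2 hΔ0)) (Int.natCast_dvd.1 h)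
    omega
  choose! y hy using fun x hx => (hs x hx).2
  rw [← Finset.card_filter_add_card_filter_not (s := s) (fun x : ℕ => (p : ℤ) ∣ Δ.eval (x : ℤ)),
    add_mul]
  refine add_le_add ?_ ?_
  · refine (Finset.card_le_card ?_).trans ((card_filter_dvd_eval_le L hlead).trans (by omega))
    exact Finset.filter_subset_filter _ fun x hx => Finset.mem_range.2 (hs x hx).1
  set I : Ideal (𝓞 K) := Ideal.span {(p : 𝓞 K)} with hI
  have hmk (a c : 𝓞 K) (h : Ideal.Quotient.mk I a = Ideal.Quotient.mk I c) : (p : 𝓞 K) ∣ a - c :=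
    Ideal.mem_span_singleton.1 (Ideal.Quotient.eq.1 h)
  have hS : Nat.card (𝓞 K ⧸ I) = p ^ μ := by
    rw [← Submodule.cardQuot_apply, ← Ideal.absNorm_apply, Ideal.absNorm_span_natCast,
      RingOfIntegers.rank]
  have : Finite (𝓞 K ⧸ I) := Nat.finite_of_card_ne_zero (by rw [hS]; exact pow_ne_zero _ hpp.ne_zero)
  have : CharP (𝓞 K ⧸ I) p := charP_of_card_eq_pow hpp Module.finrank_pos hS (by
    rw [← map_natCast (Ideal.Quotient.mk I), Ideal.Quotient.eq_zero_iff_mem]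
    exact Ideal.mem_span_singleton_self _)
  have hunit (x : ℕ) (hx : x ∈ s) (hxp : ¬ (p : ℤ) ∣ Δ.eval (x : ℤ)) :
      ∃ w : 𝓞 K, (p : 𝓞 K) ∣ f.derivative.evalEval (x : 𝓞 K) (y x) * w - 1 := by
    obtain ⟨α, β, hαβ⟩ := (Prime.coprime_iff_not_dvd (Nat.prime_iff_prime_int.1 hpp)).2 hxp
    refine ⟨v.evalEval (x : 𝓞 K) (y x) * (β : 𝓞 K), -(α : 𝓞 K), ?_⟩
    have h1 := congrArg (evalEval (x : 𝓞 K) (y x)) hΔ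
    rw [evalEval_add, evalEval_mul, evalEval_mul, hy x hx, evalEval_C, mul_zero, zero_add,
      eval_map] at h1
    have h2 : ((x : ℕ) : 𝓞 K) = Int.castRingHom (𝓞 K) (x : ℤ) := by simp
    have h3 : eval₂ (Int.castRingHom (𝓞 K)) (x : 𝓞 K) Δ = ((Δ.eval (x : ℤ) : ℤ) : 𝓞 K) := by
      rw [h2, eval₂_at_apply]; rfl
    rw [h3] at h1
    have h4 := congrArg (Int.cast : ℤ → 𝓞 K) hαβ
    push_cast at h4
    linear_combination (β : 𝓞 K) * h1 + h4
  rw [mul_assoc]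
  set s' := s.filter (fun x : ℕ => ¬ (p : ℤ) ∣ Δ.eval (x : ℤ)) with hs'
  have hs'mem (x : ℕ) (hx : x ∈ s') : x ∈ s ∧ ¬ (p : ℤ) ∣ Δ.eval (x : ℤ) := Finset.mem_filter.1 hx
  rw [← mul_assoc]
  refine (Finset.card_le_mul_card_image_of_maps_to (f := fun x => x % p) (t := Finset.range p)
    (fun x _ => Finset.mem_range.2 (Nat.mod_lt _ hpp.pos)) _ fun r hr => ?_).trans_eq
    (by rw [Finset.card_range])
  have hmodeq (x : ℕ) (hx : x % p = r) : (Ideal.Quotient.mk I (x : 𝓞 K)) = Ideal.Quotient.mk I r := by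
    rw [← hx, map_natCast, map_natCast, CharP.cast_eq_mod _ p]
  set Q : (𝓞 K ⧸ I)[X] := f.map ((Ideal.Quotient.mk I).comp (evalRingHom (r : 𝓞 K))) with hQ
  have hQeq (x : ℕ) (hx : x % p = r) :
      (Ideal.Quotient.mk I).comp (evalRingHom (x : 𝓞 K)) =
        (Ideal.Quotient.mk I).comp (evalRingHom (r : 𝓞 K)) := by
    refine Polynomial.ringHom_ext (fun a => by simp) ?_
    simpa using hmodeq x hx
  have hQeval (h : (𝓞 K)[X][X]) (x : ℕ) (hx : x % p = r) (z : 𝓞 K) :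
      (h.map ((Ideal.Quotient.mk I).comp (evalRingHom (r : 𝓞 K)))).eval (Ideal.Quotient.mk I z) =
        Ideal.Quotient.mk I (h.evalEval (x : 𝓞 K) z) := by
    rw [← hQeq x hx, ← map_map, eval_map, eval₂_at_apply, map_evalRingHom_eval]
  have hQm : Q.Monic := hf.map _
  have hfin : {a | Q.eval a = 0 ∧ IsUnit (Q.derivative.eval a)}.Finite := Set.toFinite _
  have : Nontrivial (𝓞 K ⧸ I) := CharP.nontrivial_of_char_ne_one hpp.ne_one
  have hQdeg : Q.natDegree = f.natDegree := hf.natDegree_map _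
  have hcard := card_roots_le_pow hS hQm (by rw [hQdeg]; exact hdeg)
  rw [hQdeg, Set.ncard_eq_toFinset_card _ hfin] at hcard
  refine (Finset.card_le_mul_card_image_of_maps_to (f := fun x => Ideal.Quotient.mk I (y x))
    (t := hfin.toFinset) ?_ E ?_).trans (Nat.mul_le_mul_left E hcard)
  · intro x hx
    obtain ⟨hx', hxr⟩ := Finset.mem_filter.1 hx
    obtain ⟨hxs, hxp⟩ := hs'mem x hx'
    obtain ⟨w, hw⟩ := hunit x hxs hxp
    rw [Set.Finite.mem_toFinset]
    refine ⟨?_, ?_⟩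
    · rw [hQ, hQeval f x hxr, hy x hxs, map_zero]
    · rw [hQ, derivative_map, hQeval _ x hxr]
      refine IsUnit.of_mul_eq_one (Ideal.Quotient.mk I w) ?_
      rw [← map_mul, ← map_one (Ideal.Quotient.mk I), Ideal.Quotient.eq]
      exact Ideal.mem_span_singleton.2 hw
  · intro η _
    rcases Finset.eq_empty_or_nonempty
      ((s'.filter (fun x => x % p = r)).filter fun x => Ideal.Quotient.mk I (y x) = η) with h | h
    · rw [h]; simp
    obtain ⟨x₁, hx₁⟩ := h
    simp only [Finset.mem_filter] at hx₁
    obtain ⟨⟨hx₁', hx₁r⟩, hx₁η⟩ := hx₁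
    obtain ⟨hx₁s, hx₁p⟩ := hs'mem x₁ hx₁'
    obtain ⟨w, hw⟩ := hunit x₁ hx₁s hx₁p
    refine hp₀ p (by omega) hpp.one_lt x₁ (y x₁) w (by rw [hy x₁ hx₁s]; exact dvd_zero _) hw _ ?_
    intro x hx
    obtain ⟨⟨hx', hxr⟩, hxη⟩ : (x ∈ s' ∧ x % p = r) ∧ Ideal.Quotient.mk I (y x) = η := by
      simpa [Finset.mem_filter] using hx
    obtain ⟨hxs, hxp⟩ := hs'mem x hx'
    exact ⟨(hs x hxs).1, y x, hy x hxs, hmk _ _ ((hmodeq x hxr).trans (hmodeq x₁ hx₁r).symm),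
      hmk _ _ (hxη.trans hx₁η.symm)⟩

end Counting

theorem scaleRoots_scaleRoots_of_mul_eq_one {R : Type*} [CommSemiring R] (f : R[X]) {s t : R}
    (h : s * t = 1) : (f.scaleRoots s).scaleRoots t = f := by
  ext i
  simp only [coeff_scaleRoots, natDegree_scaleRoots, mul_assoc, ← mul_pow, h, one_pow, mul_one]

theorem isUnit_scaleRoots {R : Type*} [CommRing R] [IsDomain R] {f : R[X]} (hf : IsUnit f)
    (s : R) : IsUnit (f.scaleRoots s) := by
  obtain ⟨c, -, rfl⟩ := Polynomial.isUnit_iff.1 hf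
  rwa [scaleRoots_C]

theorem irreducible_scaleRoots {R : Type*} [CommRing R] [IsDomain R] {f : R[X]}
    (hf : Irreducible f) {s : R} (hs : IsUnit s) : Irreducible (f.scaleRoots s) := by
  obtain ⟨t, hst⟩ := hs.exists_right_inv
  have hback (a : R[X]) (ha : IsUnit (a.scaleRoots t)) : IsUnit a := by
    simpa [scaleRoots_scaleRoots_of_mul_eq_one a (mul_comm s t ▸ hst)] using isUnit_scaleRoots ha s
  refine ⟨fun h => hf.not_isUnit ?_, fun a b hab => ?_⟩
  · simpa [scaleRoots_scaleRoots_of_mul_eq_one f hst] using isUnit_scaleRoots h t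
  · have h : f = a.scaleRoots t * b.scaleRoots t := by
      rw [← mul_scaleRoots_of_noZeroDivisors, ← hab, scaleRoots_scaleRoots_of_mul_eq_one f hst]
    exact (hf.isUnit_or_isUnit h).imp (hback a) (hback b)

/-- The discriminant-type identity for a monic polynomial irreducible over a domain that is
integrally closed of characteristic zero and integral over a subring `A`. -/
theorem exists_mul_add_mul_derivative_eq {A R : Type*} [CommRing A] [IsDomain A] [CommRing R]
    [IsDomain R] [CharZero R] [IsIntegrallyClosed R] [Algebra A R] [Algebra.IsIntegral A R]
    {f : R[X]} (hf : f.Monic) (hirr : Irreducible f) :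
    ∃ Δ : A, Δ ≠ 0 ∧ ∃ u v : R[X], u * f + v * derivative f = C (algebraMap A R Δ) := by
  have hinj := IsFractionRing.injective R (FractionRing R)
  have : CharZero (FractionRing R) := charZero_of_injective_algebraMap hinj
  have hsep : (f.map (algebraMap R (FractionRing R))).Separable :=
    ((hf.irreducible_iff_irreducible_map_fraction_map (K := FractionRing R)).1 hirr).separable
  obtain ⟨a, b, hab⟩ := hsep
  have clear (a : (FractionRing R)[X]) : ∃ r : R, r ≠ 0 ∧ ∃ a' : R[X],
      a'.map (algebraMap R (FractionRing R)) = C (algebraMap R (FractionRing R) r) * a := by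
    obtain ⟨r, hr, h⟩ := IsLocalization.integerNormalization_spec (nonZeroDivisors R) a
    refine ⟨r, nonZeroDivisors.ne_zero hr, _, h.trans ?_⟩
    rw [← algebraMap_smul (FractionRing R) r a, smul_eq_C_mul]
  obtain ⟨r, hr, a', ha⟩ := clear a
  obtain ⟨s, hs, b', hb⟩ := clear b
  have key : C s * a' * f + C r * b' * derivative f = C (r * s) := by
    apply Polynomial.map_injective _ hinj
    simp only [Polynomial.map_add, Polynomial.map_mul, Polynomial.map_C, ha, hb, map_mul,
      ← derivative_map]
    linear_combination C (algebraMap R (FractionRing R) r) * C (algebraMap R (FractionRing R) s) * hab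
  set I : Ideal R := (Ideal.span {f, derivative f}).comap C with hI
  have hmem : r * s ∈ I := by
    rw [hI, Ideal.mem_comap, Ideal.mem_span_pair]
    exact ⟨_, _, key⟩
  have hne := Ideal.comap_ne_bot_of_integral_mem (R := A) (mul_ne_zero hr hs) hmem
    (Algebra.IsIntegral.isIntegral _)
  obtain ⟨Δ, hΔ, hΔ0⟩ := Submodule.exists_mem_ne_zero_of_ne_bot hne
  rw [Ideal.mem_comap, hI, Ideal.mem_comap, Ideal.mem_span_pair] at hΔ
  exact ⟨Δ, hΔ0, hΔ⟩

/-- A monic polynomial over `K[X]` becomes, after scaling its roots by a nonzero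
algebraic integer, integral. -/
theorem exists_integral_scaleRoots {R K : Type*} [CommRing R] [IsDomain R] [Field K] [Algebra R K]
    [IsFractionRing R K] {f : K[X][X]} (hf : f.Monic) :
    ∃ N : R, N ≠ 0 ∧ ∃ g : R[X][X], g.Monic ∧ g.natDegree = f.natDegree ∧
      g.map (mapRingHom (algebraMap R K)) = f.scaleRoots (C (algebraMap R K N)) := by
  classical
  obtain ⟨⟨N, hN⟩, hNf⟩ := IsLocalization.exist_integer_multiples_of_finset (nonZeroDivisors R)
    (f.support.biUnion fun j => (f.coeff j).coeffs)
  have hmon : (f.scaleRoots (C (algebraMap R K N))).Monic := (monic_scaleRoots_iff _).2 hf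
  have hlift : f.scaleRoots (C (algebraMap R K N)) ∈ lifts (mapRingHom (algebraMap R K)) := by
    rw [lifts_iff_coeff_lifts]
    intro j
    rw [coeff_scaleRoots]
    rcases lt_trichotomy j f.natDegree with hj | rfl | hj
    · obtain ⟨m, hm⟩ := Nat.exists_eq_add_of_lt hj
      have : f.natDegree - j = m + 1 := by omega
      rw [this, ← C_pow]
      change _ ∈ lifts (algebraMap R K)
      rw [lifts_iff_coeff_lifts]
      intro i
      rw [coeff_mul_C]
      by_cases hi : (f.coeff j).coeff i = 0
      · exact ⟨0, by simp [hi]⟩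
      · obtain ⟨r, hr⟩ := hNf ((f.coeff j).coeff i) (Finset.mem_biUnion.2
          ⟨j, mem_support_iff.2 fun h => hi (by simp [h]), coeff_mem_coeffs hi⟩)
        refine ⟨r * N ^ m, ?_⟩
        rw [Algebra.smul_def] at hr
        rw [map_mul, hr, map_pow]
        ring
    · exact ⟨1, by simp [hf.coeff_natDegree]⟩
    · exact ⟨0, by simp [coeff_eq_zero_of_natDegree_lt hj]⟩
  obtain ⟨g, hg, hgd, hgm⟩ := lifts_and_natDegree_eq_and_monic hlift hmon
  exact ⟨N, nonZeroDivisors.ne_zero hN, g, hgm, by rw [hgd, natDegree_scaleRoots], hg⟩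

open NumberField in
theorem exists_card_filter_fieldRoot_le {K : Type*} [Field K] [NumberField K] {f : K[X][X]}
    (hf : f.Monic) (hirr : Irreducible f) (hdeg : 2 ≤ f.natDegree) :
    ∃ c : ℕ, ∀ L, 1 ≤ L → ∃ p₀ : ℕ, ∀ p, p₀ < p → p.Prime → ∀ s : Finset ℕ,
      (∀ x ∈ s, x < L * p ∧ ∃ y, f.evalEval (x : K) y = 0) → s.card ≤ c * p := by
  obtain ⟨N, hN, g, hg, hgd, hgf⟩ := exists_integral_scaleRoots (R := 𝓞 K) hf
  have hN' : algebraMap (𝓞 K) K N ≠ 0 := by simpa using hN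
  have hgirr : Irreducible g := by
    refine hg.irreducible_of_irreducible_map (mapRingHom (algebraMap (𝓞 K) K)) _ ?_
    rw [hgf]
    exact irreducible_scaleRoots hirr (isUnit_C.2 (IsUnit.mk0 _ hN'))
  let : Algebra ℤ[X] (𝓞 K)[X] := (mapRingHom (algebraMap ℤ (𝓞 K))).toAlgebra
  have : Algebra.IsIntegral ℤ[X] (𝓞 K)[X] := ⟨fun q =>
    Polynomial.isIntegral_iff_isIntegral_coeff.2 fun n => Algebra.IsIntegral.isIntegral _⟩
  obtain ⟨Δ, hΔ0, u, v, hΔ⟩ := exists_mul_add_mul_derivative_eq (A := ℤ[X]) hg hgirr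
  have hroot (φ : FractionRing (𝓞 K)[X]) :
      g.eval₂ (algebraMap (𝓞 K)[X] (FractionRing (𝓞 K)[X])) φ ≠ 0 := by
    intro h
    have h1 := (hg.irreducible_iff_irreducible_map_fraction_map
      (K := FractionRing (𝓞 K)[X])).1 hgirr
    have h2 := degree_eq_one_of_irreducible_of_root h1 (x := φ) (by rwa [IsRoot, eval_map])
    have h3 := natDegree_eq_of_degree_eq_some (n := 1) h2
    rw [hg.natDegree_map] at h3
    omega
  obtain ⟨c, hc⟩ := exists_card_filter_root_le g hg (by omega) hroot hΔ0 hΔ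
  refine ⟨c, fun L hL => (hc L hL).imp fun p₀ h p hp hpp s hs => h p hp hpp s fun x hx => ?_⟩
  obtain ⟨hxL, y, hy⟩ := hs x hx
  refine ⟨hxL, ?_⟩
  have hz : (g.map (mapRingHom (algebraMap (𝓞 K) K))).evalEval (x : K)
      (algebraMap (𝓞 K) K N * y) = 0 := by
    rw [hgf]
    have := scaleRoots_eval₂_mul (p := f) (evalRingHom (x : K)) y (C (algebraMap (𝓞 K) K N))
    simp only [eval₂_evalRingHom, coe_evalRingHom, eval_C] at this
    rw [this, hy, mul_zero]
  have hz' : eval₂ (algebraMap (𝓞 K) K) (algebraMap (𝓞 K) K N * y)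
      (g.map (evalRingHom (x : 𝓞 K))) = 0 := by
    rw [← eval_map, Polynomial.map_map, ← hz, ← map_evalRingHom_eval, Polynomial.map_map]
    congr 2
    ext <;> simp
  obtain ⟨z, hz₁⟩ := IsIntegrallyClosed.isIntegral_iff.1
    (⟨_, hg.map _, hz'⟩ : IsIntegral (𝓞 K) (algebraMap (𝓞 K) K N * y))
  refine ⟨z, ?_⟩
  rw [← hz₁, eval₂_at_apply, map_eq_zero_iff _ (RingOfIntegers.coe_injective)] at hz'
  rwa [map_evalRingHom_eval] at hz'

theorem isHilbertian_of_numberField (F : Subfield Qbar) [NumberField F] : IsHilbertian F := by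
  classical
  intro n _ f g hirr hmon hdeg hg
  have hirr' (i) : Irreducible (f i) :=
    (hmon i).irreducible_of_irreducible_map (mapRingHom F.subtype) _ (hirr i)
  choose c hc using fun i => exists_card_filter_fieldRoot_le (hmon i) (hirr' i) (hdeg i)
  set L := ∑ i, c i + 1 with hL
  choose p₀ hp₀ using fun i => hc i L (by omega)
  obtain ⟨p, hp, hprime⟩ := Nat.exists_infinite_primes (∑ i, p₀ i + g.natDegree + 1)
  let bad (i : Fin n) : Finset ℕ :=
    (Finset.range (L * p)).filter fun x => ∃ y, (f i).evalEval (x : F) y = 0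
  let zeros : Finset ℕ := (Finset.range (L * p)).filter fun x => g.eval (x : F) = 0
  have hbad (i) : (bad i).card ≤ c i * p := by
    refine hp₀ i p ?_ hprime _ fun x hx => ?_
    · have := Finset.single_le_sum (f := p₀) (fun _ _ => Nat.zero_le _) (Finset.mem_univ i)
      omega
    · simpa [bad] using hx
  have hzeros : zeros.card < p := by
    have h : (zeros.image fun x : ℕ => (x : F)).card ≤ g.natDegree := by
      refine Polynomial.card_le_degree_of_subset_roots fun x hx => ?_
      obtain ⟨y, hy, rfl⟩ := Finset.mem_image.1 (Finset.mem_def.2 hx)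
      exact (mem_roots hg).2 (Finset.mem_filter.1 hy).2
    rw [Finset.card_image_of_injective _ Nat.cast_injective] at h
    omega
  have hcard : (zeros ∪ Finset.univ.biUnion bad).card < (Finset.range (L * p)).card := by
    calc _ ≤ zeros.card + ∑ i, (bad i).card :=
          (Finset.card_union_le _ _).trans (Nat.add_le_add_left Finset.card_biUnion_le _)
      _ < p + ∑ i, c i * p := Nat.add_lt_add_of_lt_of_le hzeros (Finset.sum_le_sum fun i _ => hbad i)
      _ = _ := by rw [Finset.card_range, hL, ← Finset.sum_mul]; ring
  obtain ⟨x, hx, hx'⟩ := Finset.exists_mem_notMem_of_card_lt_card hcard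
  simp only [Finset.mem_union, Finset.mem_biUnion, Finset.mem_univ, true_and, not_or, not_exists,
    zeros, bad, Finset.mem_filter, not_and] at hx'
  refine ⟨x, hx'.1 hx, fun i y hy => hx'.2 i hx y ?_⟩
  rwa [map_evalRingHom_eval] at hy

end Hilbertian

/-- The set of Hilbertian subfields of `Q̄` is dense in the space `𝓔` of all
subfields of `Q̄`. -/
theorem hilbertian_dense : Dense {F : Subfield Qbar | IsHilbertian F} := by
  rw [dense_iff_inter_open]
  rintro _ ⟨V, hV, rfl⟩ ⟨F, hF⟩
  let : TopologicalSpace Prop := propDiscrete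
  obtain ⟨I, u, hu, hsub⟩ :=
    isOpen_pi_iff.1 (show IsOpen (X := Qbar → Prop) V from hV) (F : Set Qbar) hF
  let E : IntermediateField ℚ Qbar := IntermediateField.adjoin ℚ ((I : Set Qbar) ∩ F)
  have hint (x : Qbar) : IsIntegral ℚ x := by
    obtain ⟨q, hq, hx⟩ := ((AlgebraicClosure.isAlgebraic ℚ).isAlgebraic x).isIntegral
    exact ⟨q, hq, (congrArg (Polynomial.eval₂ · x q) (Subsingleton.elim _ _)).trans hx⟩
  have hfin : FiniteDimensional ℚ E := by
    have : Finite ((I : Set Qbar) ∩ F : Set Qbar) := (I.finite_toSet.inter_of_left _).to_subtype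
    exact IntermediateField.finiteDimensional_adjoin fun x _ => hint x
  have hEF : E.toSubfield ≤ F := by
    intro x hx
    refine Subfield.closure_le.2 (Set.union_subset ?_ Set.inter_subset_right) hx
    rintro _ ⟨q, rfl⟩
    simp
  have hnf : NumberField E.toSubfield :=
    { to_charZero := inferInstance
      to_finiteDimensional := Module.Finite.of_surjective
        (AddMonoidHom.toRatLinearMap (AddMonoidHom.id E : E →+ E.toSubfield))
        Function.surjective_id }
  refine ⟨E.toSubfield, hsub fun a ha => ?_, isHilbertian_of_numberField _⟩
  have hmem : (a ∈ E.toSubfield) = (a ∈ F) := propext ⟨fun h => hEF h, fun h =>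
    IntermediateField.subset_adjoin ℚ _ ⟨ha, h⟩⟩
  change (a ∈ E.toSubfield) ∈ u a
  rw [hmem]
  exact (hu a ha).2
end
end
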